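/- Let k ≥ 2 and δ = 8^{−2k}. There exists a real number K ≥ 1, depending only on k, such that for all sufficiently large P the following holds: if λ is a nonzero real number and α a real number with |f(λα)| ≥ P^{1−11δ}, where f(α) = Σ_{|x| ≤ P} e(α x^k), then there exist integers a and q with 1 ≤ q ≤ K P^{11kδ} and |λα − a/q| ≤ q^{−1} K P^{11kδ − k}. -/

import Mathlib

open MeasureTheory

/-- e(t) = e^{2πit}. -/
noncomputable def eF (t : ℝ) : ℂ := Complex.exp (2 * Real.pi * Complex.I * t)

/-- The Weyl sum f(α) = Σ_{x ∈ ℤ, |x| ≤ P} e(α x^k). -/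
noncomputable def fW (k : ℕ) (P α : ℝ) : ℂ :=
  ∑ x ∈ Finset.Icc (-(⌊P⌋ : ℤ)) ⌊P⌋, eF (α * (x : ℝ) ^ k)

/-- δ = 8^{−2k}. -/
noncomputable def dlt (k : ℕ) : ℝ := ((8 : ℝ) ^ (2 * k))⁻¹

lemma eF_add (s t : ℝ) : eF (s + t) = eF s * eF t := by
  simp only [eF, ← Complex.exp_add]
  push_cast
  ring_nf

lemma eF_eq_exp_I_mul (t : ℝ) : eF t = Complex.exp (Complex.I * ((2 * Real.pi * t : ℝ) : ℂ)) := by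
  rw [eF]
  push_cast
  ring_nf

@[simp] lemma norm_eF (t : ℝ) : ‖eF t‖ = 1 := by
  rw [eF_eq_exp_I_mul, mul_comm, Complex.norm_exp_ofReal_mul_I]

@[simp] lemma eF_zero : eF 0 = 1 := by simp [eF]

lemma eF_intCast (n : ℤ) : eF n = 1 := by
  rw [eF, Complex.exp_eq_one_iff]
  exact ⟨n, by push_cast; ring⟩

lemma eF_neg (t : ℝ) : eF (-t) = (starRingEnd ℂ) (eF t) := by
  rw [eF, eF, ← Complex.exp_conj]
  congr 1
  simp [map_ofNat]

lemma eF_sub (s t : ℝ) : eF (s - t) = eF s * (starRingEnd ℂ) (eF t) := by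
  rw [sub_eq_add_neg, eF_add, eF_neg]

lemma eF_add_intCast (t : ℝ) (n : ℤ) : eF (t + n) = eF t := by
  rw [eF_add, eF_intCast, mul_one]

lemma eF_natCast_mul (n : ℕ) (t : ℝ) : eF (n * t) = eF t ^ n := by
  rw [eF, eF, ← Complex.exp_nat_mul]
  push_cast
  ring_nf

lemma norm_eF_sub_one_le (t : ℝ) : ‖eF t - 1‖ ≤ 2 * Real.pi * |t| := by
  rw [eF_eq_exp_I_mul]
  refine Real.norm_exp_I_mul_ofReal_sub_one_le.trans_eq ?_
  rw [Real.norm_eq_abs, abs_mul, abs_of_pos Real.two_pi_pos]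

lemma norm_eF_sub_eF_le (s t : ℝ) : ‖eF s - eF t‖ ≤ 2 * Real.pi * |s - t| := by
  have h : eF s - eF t = eF t * (eF (s - t) - 1) := by
    rw [mul_sub, ← eF_add, mul_one, add_sub_cancel]
  rw [h, norm_mul, norm_eF, one_mul]
  exact norm_eF_sub_one_le _

lemma four_mul_abs_sub_round_le (t : ℝ) : 4 * |t - round t| ≤ ‖eF t - 1‖ := by
  have h1 : eF t = eF (t - round t) := by
    rw [← eF_add_intCast (t - round t) (round t), sub_add_cancel]
  have h2 := abs_sub_round t
  set u := t - round t
  have hpi := Real.pi_pos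
  rw [h1, eF_eq_exp_I_mul, Complex.norm_exp_I_mul_ofReal_sub_one]
  have h3 : |Real.pi * u| ≤ Real.pi / 2 := by
    rw [abs_mul, abs_of_pos hpi]
    nlinarith
  have h4 := Real.mul_abs_le_abs_sin h3
  rw [abs_mul, abs_of_pos hpi, ← mul_assoc, div_mul_cancel₀ _ hpi.ne'] at h4
  rw [show 2 * Real.pi * u / 2 = Real.pi * u by ring, Real.norm_eq_abs, abs_mul, abs_two]
  linarith

/-- The bound for a geometric sum `∑ e(γx + c)`. -/
lemma norm_sum_eF_linear_mul_le (γ c : ℝ) (n : ℕ) :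
    ‖∑ x ∈ Finset.range n, eF (γ * x + c)‖ * |γ - round γ| ≤ 1 / 2 := by
  have h1 : ∑ x ∈ Finset.range n, eF (γ * x + c) =
      eF c * ∑ x ∈ Finset.range n, eF γ ^ x := by
    rw [Finset.mul_sum]
    refine Finset.sum_congr rfl fun x _ => ?_
    rw [← eF_natCast_mul, ← eF_add]
    ring_nf
  have h2 := congrArg norm (mul_neg_geom_sum (eF γ) n)
  rw [norm_mul, norm_sub_rev] at h2
  have h3 : ‖1 - eF γ ^ n‖ ≤ 2 := by
    refine (norm_sub_le _ _).trans ?_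
    simp only [norm_one, norm_pow, norm_eF, one_pow]
    norm_num
  have h4 := four_mul_abs_sub_round_le γ
  rw [h1, norm_mul, norm_eF, one_mul]
  nlinarith [norm_nonneg (∑ x ∈ Finset.range n, eF γ ^ x)]

lemma norm_sq_sum_range_le (z : ℕ → ℂ) (hz : ∀ x, ‖z x‖ = 1) (n : ℕ) :
    ‖∑ x ∈ Finset.range n, z x‖ ^ 2 ≤ n + 2 * ∑ h ∈ Finset.range n,
      ‖∑ x ∈ Finset.range (n - (h + 1)), z (x + (h + 1)) * (starRingEnd ℂ) (z x)‖ := by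
  have key : ‖∑ x ∈ Finset.range n, z x‖ ^ 2 = n + 2 * (∑ h ∈ Finset.range n,
      ∑ x ∈ Finset.range (n - (h + 1)), z (x + (h + 1)) * (starRingEnd ℂ) (z x)).re := by
    induction n with
    | zero => simp
    | succ n ih =>
      have h1 : ∑ h ∈ Finset.range (n + 1), ∑ x ∈ Finset.range (n + 1 - (h + 1)),
          z (x + (h + 1)) * (starRingEnd ℂ) (z x) =
          (∑ h ∈ Finset.range n, ∑ x ∈ Finset.range (n - (h + 1)),
            z (x + (h + 1)) * (starRingEnd ℂ) (z x)) +
          z n * (starRingEnd ℂ) (∑ x ∈ Finset.range n, z x) := by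
        rw [Finset.sum_range_succ, map_sum, Finset.mul_sum, ← Finset.sum_range_reflect
          (fun x => z n * (starRingEnd ℂ) (z x)), ← Finset.sum_add_distrib]
        simp only [Nat.sub_self, Finset.range_zero, Finset.sum_empty, add_zero]
        refine Finset.sum_congr rfl fun h hh => ?_
        have hh := Finset.mem_range.1 hh
        rw [show n + 1 - (h + 1) = (n - (h + 1)) + 1 by omega, Finset.sum_range_succ,
          show n - (h + 1) + (h + 1) = n by omega, show n - 1 - h = n - (h + 1) by omega]
      rw [h1, Finset.sum_range_succ, ← Complex.normSq_eq_norm_sq, Complex.normSq_add,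
        Complex.normSq_eq_norm_sq, Complex.normSq_eq_norm_sq, ih, hz, Complex.add_re,
        ← Complex.conj_re (z n * _)]
      simp only [map_mul, Complex.conj_conj]
      push_cast
      rw [mul_comm ((starRingEnd ℂ) (z n))]
      ring
  rw [key]
  gcongr
  refine (Complex.re_le_norm _).trans (norm_sum_le _ _)

/-- If `γ h + c` is within `ε` of an integer for many `h < N`, then some small multiple of `γ` is
very close to an integer. -/
lemma exists_small_mul_near_int {γ c ε : ℝ} {N D B t : ℕ} {H : Finset ℕ}
    (hH : H ⊆ Finset.range N) (hnear : ∀ h ∈ H, ∃ n : ℤ, |h * γ + c - n| ≤ ε)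
    (hD : 1 ≤ D) (hcard : N / D + 1 < H.card) (hB : 4 * ε * N ≤ B)
    (ht : (2 * B + 1) * t < H.card) :
    ∃ d : ℕ, 1 ≤ d ∧ d ≤ D ∧ ∃ a : ℤ, |d * γ - a| * t ≤ 2 * ε * D := by
  classical
  choose! f hf using hnear
  -- Two elements of `H` at distance less than `D`.
  obtain ⟨h₁, h₂, hh₁, hh₂, hlt, hgap⟩ : ∃ h₁ h₂, h₁ ∈ H ∧ h₂ ∈ H ∧ h₂ < h₁ ∧ h₁ - h₂ ≤ D := by
    have hmap : Set.MapsTo (fun h => h / D) (H : Set ℕ) (Finset.range (N / D + 1) : Set ℕ) := by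
      intro h hh
      have := Finset.mem_range.1 (hH hh)
      simp only [Finset.coe_range, Set.mem_Iio]
      exact Nat.lt_succ_of_le (Nat.div_le_div_right this.le)
    obtain ⟨x, hx, y, hy, hxy, he⟩ := Finset.exists_ne_map_eq_of_card_lt_of_maps_to
      (by simpa using hcard) hmap
    have hx1 := Nat.div_add_mod x D
    have hy1 := Nat.div_add_mod y D
    have hx2 := Nat.mod_lt x hD
    have hy2 := Nat.mod_lt y hD
    rw [he] at hx1
    rcases lt_or_gt_of_ne hxy with h | h
    · exact ⟨y, x, hy, hx, h, by omega⟩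
    · exact ⟨x, y, hx, hy, h, by omega⟩
  set d := h₁ - h₂ with hd
  have hdpos : 1 ≤ d := by omega
  have hdR : (d : ℝ) = h₁ - h₂ := by rw [hd, Nat.cast_sub hlt.le]
  have hdN : (d : ℝ) ≤ N := by
    have := Finset.mem_range.1 (hH hh₁)
    exact_mod_cast (by omega : d ≤ N)
  have hε : 0 ≤ ε := (abs_nonneg _).trans (hf h₁ hh₁)
  set a : ℤ := f h₁ - f h₂
  refine ⟨d, hdpos, hgap, a, ?_⟩
  -- The points `(h, f h)` lie on few lines of direction `(d, a)`.
  have hmap : ∀ h ∈ H, (d * (f h - f h₂) - a * (h - h₂) : ℤ) ∈ Finset.Icc (-(B : ℤ)) B := by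
    intro h hh
    have e1 := abs_le.1 (hf h hh)
    have e2 := abs_le.1 (hf h₁ hh₁)
    have e3 := abs_le.1 (hf h₂ hh₂)
    have hN : |(h : ℝ) - h₂| ≤ N := by
      have i1 : (h : ℝ) ≤ N := by exact_mod_cast (Finset.mem_range.1 (hH hh)).le
      have i2 : (h₂ : ℝ) ≤ N := by exact_mod_cast (Finset.mem_range.1 (hH hh₂)).le
      have i3 : (0 : ℝ) ≤ h := by positivity
      have i4 : (0 : ℝ) ≤ h₂ := by positivity
      rw [abs_le]; constructor <;> linarith
    have key : ((d * (f h - f h₂) - a * (h - h₂) : ℤ) : ℝ) =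
        ((h * γ + c - f h) - (h₂ * γ + c - f h₂)) * (-d) +
        ((h₁ * γ + c - f h₁) - (h₂ * γ + c - f h₂)) * (h - h₂) := by
      simp only [a]
      push_cast
      rw [hdR]
      ring
    have hb : |((d * (f h - f h₂) - a * (h - h₂) : ℤ) : ℝ)| ≤ B := by
      rw [key]
      refine ((abs_add_le _ _).trans ?_).trans hB
      rw [abs_mul, abs_mul, abs_neg, Nat.abs_cast]
      have j1 : |(h * γ + c - f h) - (h₂ * γ + c - f h₂)| ≤ 2 * ε := by
        rw [abs_le]; constructor <;> linarith
      have j2 : |(h₁ * γ + c - f h₁) - (h₂ * γ + c - f h₂)| ≤ 2 * ε := by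
        rw [abs_le]; constructor <;> linarith
      have k1 := mul_le_mul j1 hdN (by positivity) (by positivity)
      have k2 := mul_le_mul j2 hN (by positivity) (by positivity)
      linarith
    rw [Finset.mem_Icc, ← abs_le]
    exact_mod_cast hb
  obtain ⟨y, -, hy⟩ := Finset.exists_lt_card_fiber_of_mul_lt_card_of_maps_to (n := t) hmap
    (by
      rw [Int.card_Icc]
      convert ht using 2
      omega)
  set F := {h ∈ H | (d * (f h - f h₂) - a * (h - h₂) : ℤ) = y} with hFdef
  have hFne : F.Nonempty := Finset.card_pos.1 (by omega)
  set u := F.max' hFne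
  set v := F.min' hFne
  have huF : u ∈ F := F.max'_mem hFne
  have hvF : v ∈ F := F.min'_mem hFne
  have hsub : F ⊆ Finset.Icc v u := fun x hx =>
    Finset.mem_Icc.2 ⟨F.min'_le x hx, F.le_max' x hx⟩
  have hspread : t + v ≤ u := by
    have := Finset.card_le_card hsub
    rw [Nat.card_Icc] at this
    omega
  simp only [hFdef, Finset.mem_filter] at huF hvF
  have hcol : (d : ℝ) * (f u - f v) = a * (u - v) := by
    have : (d * (f u - f v) : ℤ) = a * (u - v) := by linarith [huF.2, hvF.2]
    exact_mod_cast this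
  have e1 := abs_le.1 (hf u huF.1)
  have e2 := abs_le.1 (hf v hvF.1)
  have htu : (t : ℝ) ≤ u - v := by
    have : (t : ℝ) + v ≤ u := by exact_mod_cast hspread
    linarith
  have huv : (0 : ℝ) ≤ u - v := le_trans (by positivity) htu
  calc |d * γ - a| * t ≤ |d * γ - a| * (u - v) := by gcongr
    _ = |(d * γ - a) * (u - v)| := by rw [abs_mul, abs_of_nonneg huv]
    _ = |((u * γ + c - f u) - (v * γ + c - f v)) * d| := by
        congr 1
        linear_combination hcol
    _ = |(u * γ + c - f u) - (v * γ + c - f v)| * d := by rw [abs_mul, Nat.abs_cast]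
    _ ≤ 2 * ε * D := by
        refine mul_le_mul ?_ (by exact_mod_cast hgap) (by positivity) (by positivity)
        rw [abs_le]; constructor <;> linarith

/-- `φ` behaves like a polynomial of degree at most `j + 1`, and `γ` is `(j + 1)!` times its
coefficient of degree `j + 1`. -/
def HasLeadingDiff : ℕ → ℝ → (ℕ → ℝ) → Prop
  | 0, γ, φ => ∃ c : ℝ, ∀ x : ℕ, φ x = γ * x + c
  | j + 1, γ, φ => ∀ h : ℕ,
      HasLeadingDiff j ((h + 1 : ℕ) * γ) fun x => φ (x + (h + 1)) - φ x

open Polynomial in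
lemma hasLeadingDiff_eval (j : ℕ) (p : ℝ[X]) (hp : p.natDegree ≤ j + 1) :
    HasLeadingDiff j ((j + 1).factorial * p.coeff (j + 1)) fun x => p.eval (x : ℝ) := by
  induction j generalizing p with
  | zero =>
    refine ⟨p.coeff 0, fun x => ?_⟩
    beta_reduce
    rw [eval_eq_sum_range' (Nat.lt_succ_of_le hp)]
    simp [Finset.sum_range_succ]
    ring
  | succ j ih =>
    intro h
    set q : ℝ[X] := taylor ((h + 1 : ℕ) : ℝ) p - p with hq
    have htop : q.coeff (j + 1) = (j + 2) * ((h + 1 : ℕ) : ℝ) * p.coeff (j + 2) := by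
      rw [hq, coeff_sub, taylor_coeff, eval_eq_sum_range' (n := 2)
        ((natDegree_hasseDeriv_le p (j + 1)).trans_lt (by omega))]
      simp only [hasseDeriv_coeff, Finset.sum_range_succ, Finset.range_zero, Finset.sum_empty]
      rw [show 1 + (j + 1) = j + 2 by ring, show j + 2 = (j + 1) + 1 by ring,
        Nat.choose_succ_self_right]
      simp
      ring
    have hdeg : q.natDegree ≤ j + 1 := by
      rw [natDegree_le_iff_coeff_eq_zero]
      intro m hm
      rw [hq, coeff_sub, taylor_coeff, eval_eq_sum_range' (n := 1)
        ((natDegree_hasseDeriv_le p m).trans_lt (by omega))]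
      simp [hasseDeriv_coeff]
    have := ih q hdeg
    rw [htop] at this
    convert this using 1
    · rw [Nat.factorial_succ (j + 1)]
      push_cast
      ring
    · funext x
      rw [hq, eval_sub, taylor_eval]
      push_cast
      rfl

lemma hasLeadingDiff_pow (j : ℕ) (α : ℝ) :
    HasLeadingDiff j ((j + 1).factorial * α) fun x => α * (x : ℝ) ^ (j + 1) := by
  have := hasLeadingDiff_eval j (Polynomial.C α * Polynomial.X ^ (j + 1))
    (Polynomial.natDegree_C_mul_X_pow_le _ _)
  simpa using this

/-- Many large differenced sums, arising from one large exponential sum. -/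
lemma card_large_diff_sums {φ : ℕ → ℝ} {N n : ℕ} {R : ℝ} (hR : 1 ≤ R) (hn : n ≤ N)
    (hN : 2 * R ^ 2 ≤ N) (hlarge : N / R ≤ ‖∑ x ∈ Finset.range n, eF (φ x)‖) :
    N / (8 * R ^ 2) ≤ (({h ∈ Finset.range n | N / (8 * R ^ 2) ≤ ‖∑ x ∈ Finset.range (n - (h + 1)),
      eF (φ (x + (h + 1)) - φ x)‖}).card : ℝ) := by
  classical
  set S : ℕ → ℝ := fun h => ‖∑ x ∈ Finset.range (n - (h + 1)), eF (φ (x + (h + 1)) - φ x)‖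
  set H := {h ∈ Finset.range n | N / (8 * R ^ 2) ≤ S h} with hH
  have hR0 : 0 < R := by linarith
  have hN0 : (0 : ℝ) < N := by nlinarith
  have hnN : (n : ℝ) ≤ N := by exact_mod_cast hn
  have h1 := norm_sq_sum_range_le (fun x => eF (φ x)) (fun x => norm_eF _) n
  simp only [← eF_sub] at h1
  change _ ≤ (n : ℝ) + 2 * ∑ h ∈ Finset.range n, S h at h1
  have h2 : (N / R) ^ 2 ≤ ‖∑ x ∈ Finset.range n, eF (φ x)‖ ^ 2 := by gcongr
  have h3 : ∑ h ∈ Finset.range n, S h ≤ H.card * N + N * (N / (8 * R ^ 2)) := by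
    rw [← Finset.sum_filter_add_sum_filter_not _ (fun h => N / (8 * R ^ 2) ≤ S h)]
    refine add_le_add ?_ ?_
    · rw [← nsmul_eq_mul]
      refine Finset.sum_le_card_nsmul _ _ _ fun h _ => ?_
      refine (norm_sum_le _ _).trans ?_
      simp only [norm_eF, Finset.sum_const, Finset.card_range, nsmul_eq_mul, mul_one]
      exact_mod_cast (by omega : n - (h + 1) ≤ N)
    · refine (Finset.sum_le_card_nsmul _ _ (N / (8 * R ^ 2)) fun h hh => ?_).trans ?_
      · exact (not_le.1 (Finset.mem_filter.1 hh).2).le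
      · rw [nsmul_eq_mul]
        gcongr
        exact (Finset.card_filter_le _ _).trans (by simpa using hn)
  have h4 : (N : ℝ) ≤ (N / R) ^ 2 / 2 := by
    rw [div_pow, div_div, le_div_iff₀ (by positivity)]
    nlinarith
  have h5 : (N : ℝ) * (N / (8 * R ^ 2)) = (N / R) ^ 2 / 8 := by
    field_simp
  have h6 : (N : ℝ) * (N / (8 * R ^ 2)) ≤ N * H.card := by nlinarith
  exact le_of_mul_le_mul_left h6 hN0

/-- A large Weyl sum forces its leading coefficient to be close to a rational number with small
denominator. -/
lemma exists_near_int_of_large_sum (j : ℕ) : ∃ C : ℝ, 1 ≤ C ∧ ∀ (R γ : ℝ) (N n : ℕ) (φ : ℕ → ℝ),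
    1 ≤ R → n ≤ N → C * R ^ 16 ^ (j + 1) ≤ N → HasLeadingDiff j γ φ →
    N / R ≤ ‖∑ x ∈ Finset.range n, eF (φ x)‖ →
    ∃ q : ℕ, 1 ≤ q ∧ (q : ℝ) ≤ C * R ^ 16 ^ (j + 1) ∧
      ∃ a : ℤ, |q * γ - a| * N ^ (j + 1) ≤ C * R ^ 16 ^ (j + 1) := by
  classical
  induction j with
  | zero =>
    refine ⟨1, le_rfl, fun R γ N n φ hR hn hN ⟨c, hc⟩ hlarge => ?_⟩
    have hR0 : 0 < R := by linarith
    have hR1 : R ≤ R ^ 16 := le_self_pow₀ hR (by norm_num)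
    simp only [zero_add, pow_one, one_mul]
    refine ⟨1, le_rfl, by push_cast; linarith, round γ, ?_⟩
    have h1 := norm_sum_eF_linear_mul_le γ c n
    simp only [hc] at hlarge
    have h2 : N / R * |γ - round γ| ≤ 1 / 2 :=
      (mul_le_mul_of_nonneg_right hlarge (abs_nonneg _)).trans h1
    rw [div_mul_eq_mul_div, div_le_iff₀ hR0] at h2
    rw [Nat.cast_one, one_mul]
    linarith
  | succ j ih =>
    obtain ⟨C, hC, ih⟩ := ih
    set A := 16 ^ (j + 1) with hA
    have hA1 : 1 ≤ A := Nat.one_le_pow _ _ (by norm_num)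
    have hAA : 16 ^ (j + 1 + 1) = 16 * A := by rw [hA, pow_succ]; ring
    set C' : ℝ := 9216 * C ^ 4 * 8 ^ (4 * A) with hC'
    have hC'1 : 1 ≤ C' := by
      have h1 : 1 ≤ C ^ 4 := one_le_pow₀ hC
      have h2 : (1 : ℝ) ≤ 8 ^ (4 * A) := one_le_pow₀ (by norm_num)
      rw [hC']
      nlinarith
    refine ⟨C', hC'1, fun R γ N n φ hR hn hN hφ hlarge => ?_⟩
    rw [hAA] at hN ⊢
    set R' : ℝ := 8 * R ^ 2 with hR'
    set Q : ℝ := C * R' ^ A with hQ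
    have hR'8 : 8 ≤ R' := by nlinarith
    have hQ1 : 1 ≤ Q := one_le_mul_of_one_le_of_one_le hC (one_le_pow₀ (by linarith))
    have hZ : 144 * R' ^ 2 * Q ^ 4 ≤ C' * R ^ (16 * A) := by
      have e : 144 * R' ^ 2 * Q ^ 4 = C' * R ^ (8 * A + 4) := by
        rw [hQ, hR', hC']
        ring
      rw [e]
      gcongr
      omega
    set Z := C' * R ^ (16 * A)
    have hQ2 : 1 ≤ Q ^ 2 := one_le_pow₀ hQ1
    have hQ24 : Q ^ 2 ≤ Q ^ 4 := pow_le_pow_right₀ hQ1 (by norm_num)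
    have hQQ2 : Q ≤ Q ^ 2 := le_self_pow₀ hQ1 (by norm_num)
    have hRR : 8 * R' ≤ R' ^ 2 := by nlinarith
    have hRQ2 : 1152 * (R' * Q ^ 2) ≤ Z := by
      calc 1152 * (R' * Q ^ 2) = 144 * (8 * R') * Q ^ 2 := by ring
        _ ≤ 144 * R' ^ 2 * Q ^ 4 := by gcongr
        _ ≤ Z := hZ
    have hRQ : R' * Q ≤ R' * Q ^ 2 := by gcongr
    have hR'R' : R' ≤ R' * Q := le_mul_of_one_le_right (by linarith) hQ1
    have hN0 : (0 : ℝ) < N := by linarith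
    have hN1 : 1 ≤ N := by exact_mod_cast hN0
    have hcard := card_large_diff_sums hR hn (by linarith) hlarge
    rw [← hR'] at hcard
    set H := {h ∈ Finset.range n | N / R' ≤ ‖∑ x ∈ Finset.range (n - (h + 1)),
      eF (φ (x + (h + 1)) - φ x)‖} with hH
    have hQN : Q ≤ N := by nlinarith
    have hex : ∀ h ∈ H, ∃ q : ℕ, 1 ≤ q ∧ (q : ℝ) ≤ Q ∧
        ∃ a : ℤ, |q * (((h + 1 : ℕ) : ℝ) * γ) - a| * N ^ (j + 1) ≤ Q := fun h hh =>
      ih R' (((h + 1 : ℕ) : ℝ) * γ) N (n - (h + 1)) _ (by linarith) (by omega) hQN (hφ h)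
        (Finset.mem_filter.1 hh).2
    choose! q hq1 hqQ b hb using hex
    obtain ⟨q₀, hq₀, hfib⟩ := Finset.exists_le_card_fiber_of_nsmul_le_card_of_maps_to
      (s := H) (t := Finset.Icc 1 ⌊Q⌋₊) (f := q) (b := N / (R' * Q))
      (fun h hh => Finset.mem_Icc.2 ⟨hq1 h hh, Nat.le_floor (hqQ h hh)⟩)
      ⟨1, Finset.mem_Icc.2 ⟨le_rfl, Nat.le_floor (by simpa using hQ1)⟩⟩
      (by
        rw [Nat.card_Icc, nsmul_eq_mul, Nat.add_sub_cancel]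
        refine le_trans ?_ hcard
        calc (⌊Q⌋₊ : ℝ) * (N / (R' * Q)) ≤ Q * (N / (R' * Q)) := by
              gcongr
              exact Nat.floor_le (by linarith)
          _ = N / R' := by field_simp)
    rw [Finset.mem_Icc] at hq₀
    have hq₀Q : (q₀ : ℝ) ≤ Q := (Nat.le_floor_iff (by linarith)).1 hq₀.2
    set F := {h ∈ H | q h = q₀} with hF
    have hRQpos : 0 < R' * Q := by positivity
    have hRQ2pos : 0 < R' * Q ^ 2 := by positivity
    set D := ⌈2 * (R' * Q)⌉₊
    have hD2 : (D : ℝ) ≤ 3 * (R' * Q) := by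
      have := Nat.ceil_lt_add_one (a := 2 * (R' * Q)) (by positivity)
      nlinarith
    have hD1 : 2 * (R' * Q) ≤ D := Nat.le_ceil _
    have hDpos : 1 ≤ D := by
      have : (1 : ℝ) ≤ D := by nlinarith
      exact_mod_cast this
    set B := ⌈4 * Q⌉₊
    have hB2 : (B : ℝ) ≤ 5 * Q := by
      have := Nat.ceil_lt_add_one (a := 4 * Q) (by positivity)
      linarith
    have hB1 : 4 * Q ≤ B := Nat.le_ceil _
    set t := ⌊N / (12 * (R' * Q ^ 2))⌋₊
    have ht1 : (t : ℝ) ≤ N / (12 * (R' * Q ^ 2)) := Nat.floor_le (by positivity)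
    have ht2 : N / (24 * (R' * Q ^ 2)) ≤ t := by
      have h1 := (Nat.lt_floor_add_one (N / (12 * (R' * Q ^ 2))))
      have h2 : (1 : ℝ) ≤ N / (24 * (R' * Q ^ 2)) := by
        rw [le_div_iff₀ (by positivity)]
        linarith
      have h3 : N / (12 * (R' * Q ^ 2)) = 2 * (N / (24 * (R' * Q ^ 2))) := by
        field_simp
        norm_num
      change _ < (t : ℝ) + 1 at h1
      linarith
    have hNj : (0 : ℝ) < (N : ℝ) ^ (j + 1) := by positivity
    obtain ⟨d, hd1, hdD, a, ha⟩ := exists_small_mul_near_int (γ := q₀ * γ) (c := q₀ * γ)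
      (ε := Q / N ^ (j + 1)) (N := N) (D := D) (B := B) (t := t) (H := F)
      (fun h hh => Finset.mem_range.2 (by
        have := Finset.mem_range.1 (Finset.mem_filter.1 (Finset.mem_filter.1 hh).1).1
        omega))
      (fun h hh => by
        obtain ⟨hhH, rfl⟩ := Finset.mem_filter.1 hh
        refine ⟨b h, ?_⟩
        rw [le_div_iff₀ hNj]
        have e : (h : ℝ) * (q h * γ) + q h * γ - b h = q h * (((h + 1 : ℕ) : ℝ) * γ) - b h := by
          push_cast
          ring
        rw [e]
        exact hb h hhH)
      hDpos
      (by
        have h1 : ((N / D : ℕ) : ℝ) ≤ N / (2 * (R' * Q)) :=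
          Nat.cast_div_le.trans (by gcongr)
        have h2 : N / (R' * Q) = 2 * (N / (2 * (R' * Q))) := by
          field_simp
        have h3 : (1 : ℝ) < N / (2 * (R' * Q)) := by
          rw [lt_div_iff₀ (by positivity)]
          linarith
        have h4 : ((N / D + 1 : ℕ) : ℝ) < F.card := by
          push_cast
          linarith
        exact_mod_cast h4)
      (by
        refine le_trans ?_ hB1
        rw [mul_div_assoc', div_mul_eq_mul_div, div_le_iff₀ hNj]
        gcongr
        exact le_self_pow₀ (by exact_mod_cast hN1) (by omega))
      (by
        have h1 : (((2 * B + 1) * t : ℕ) : ℝ) < F.card := by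
          push_cast
          calc (2 * (B : ℝ) + 1) * t ≤ (11 * Q) * (N / (12 * (R' * Q ^ 2))) := by
                gcongr
                linarith
            _ < N / (R' * Q) := by
                rw [mul_div_assoc', div_lt_div_iff₀ (by positivity) (by positivity)]
                have : 0 < Q * N * (R' * Q) := by positivity
                linarith
            _ ≤ F.card := hfib
        exact_mod_cast h1)
    refine ⟨d * q₀, Nat.mul_pos hd1 hq₀.1, ?_, a, ?_⟩
    · push_cast
      calc (d : ℝ) * q₀ ≤ (3 * (R' * Q)) * Q := by
            gcongr
            exact le_trans (by exact_mod_cast hdD) hD2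
        _ ≤ Z := by nlinarith
    · have ha' : |d * (q₀ * γ) - a| * (N / (24 * (R' * Q ^ 2))) ≤
          2 * (Q / N ^ (j + 1)) * (3 * (R' * Q)) :=
        (mul_le_mul_of_nonneg_left ht2 (abs_nonneg _)).trans (ha.trans (by gcongr))
      rw [mul_div_assoc', div_le_iff₀ (by positivity)] at ha'
      refine le_trans ?_ hZ
      push_cast
      rw [mul_assoc (d : ℝ)]
      calc |d * (q₀ * γ) - a| * (N : ℝ) ^ (j + 1 + 1)
          = (|d * (q₀ * γ) - a| * N) * N ^ (j + 1) := by ring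
        _ ≤ (2 * (Q / N ^ (j + 1)) * (3 * (R' * Q)) * (24 * (R' * Q ^ 2))) * N ^ (j + 1) := by
            gcongr
        _ = 144 * R' ^ 2 * Q ^ 4 := by
            field_simp
            ring

lemma exists_rat_approx_of_large_weyl_sum {k : ℕ} (hk : 1 ≤ k) : ∃ C : ℝ, 1 ≤ C ∧
    ∀ (R α : ℝ) (N : ℕ), 1 ≤ R → C * R ^ 16 ^ k ≤ N →
    N / R ≤ ‖∑ x ∈ Finset.range N, eF (α * (x : ℝ) ^ k)‖ →
    ∃ q : ℕ, 1 ≤ q ∧ (q : ℝ) ≤ C * R ^ 16 ^ k ∧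
      ∃ a : ℤ, |q * α - a| * N ^ k ≤ C * R ^ 16 ^ k := by
  obtain ⟨j, rfl⟩ : ∃ j, k = j + 1 := ⟨k - 1, by omega⟩
  obtain ⟨C, hC, h⟩ := exists_near_int_of_large_sum j
  have hf : (1 : ℝ) ≤ (j + 1).factorial := by
    exact_mod_cast Nat.one_le_iff_ne_zero.2 (Nat.factorial_ne_zero _)
  refine ⟨(j + 1).factorial * C, one_le_mul_of_one_le_of_one_le hf hC,
    fun R α N hR hN hlarge => ?_⟩
  have hpos : 0 ≤ C * R ^ 16 ^ (j + 1) := by positivity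
  have hle : C * R ^ 16 ^ (j + 1) ≤ (j + 1).factorial * C * R ^ 16 ^ (j + 1) := by
    rw [mul_assoc]
    exact le_mul_of_one_le_left hpos hf
  obtain ⟨q, hq1, hq2, a, ha⟩ := h R _ N N _ hR le_rfl (hle.trans hN) (hasLeadingDiff_pow j α)
    hlarge
  refine ⟨q * (j + 1).factorial, Nat.mul_pos hq1 (Nat.factorial_pos _), ?_, a, ?_⟩
  · push_cast
    nlinarith
  · push_cast
    rw [mul_assoc (q : ℝ)]
    exact ha.trans hle

lemma norm_sum_mul_sub_le {w : ℕ → ℝ} (hw : Antitone w) (hw0 : ∀ i, 0 ≤ w i) {z : ℕ → ℂ}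
    (hz : ∀ i, ‖z i‖ ≤ 1) (n : ℕ) :
    ‖∑ i ∈ Finset.range n, (w i : ℂ) * (z (i + 1) - z i)‖ ≤ 2 * w 0 := by
  have hwz : ∀ i j, w i ≤ w j → ‖((w j : ℂ) - w i) * z (i)‖ ≤ w j - w i := fun i j hij => by
    rw [← Complex.ofReal_sub, norm_mul, Complex.norm_real, Real.norm_eq_abs,
      abs_of_nonneg (sub_nonneg.2 hij)]
    exact mul_le_of_le_one_right (sub_nonneg.2 hij) (hz i)
  have hz' : ∀ i, ‖(w i : ℂ) * z i‖ ≤ w i := fun i => by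
    rw [norm_mul, Complex.norm_real, Real.norm_eq_abs, abs_of_nonneg (hw0 i)]
    exact mul_le_of_le_one_right (hw0 i) (hz i)
  have key : ‖∑ i ∈ Finset.range n, (w i : ℂ) * (z (i + 1) - z i) - w n * z n‖ ≤
      2 * w 0 - w n := by
    induction n with
    | zero =>
      rw [Finset.sum_range_zero, zero_sub, norm_neg]
      linarith [hz' 0]
    | succ n ih =>
      have e : ∑ i ∈ Finset.range (n + 1), (w i : ℂ) * (z (i + 1) - z i) - w (n + 1) * z (n + 1) =
          (∑ i ∈ Finset.range n, (w i : ℂ) * (z (i + 1) - z i) - w n * z n) +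
          ((w n : ℂ) - w (n + 1)) * z (n + 1) := by
        rw [Finset.sum_range_succ]
        ring
      rw [e]
      refine (norm_add_le _ _).trans ?_
      linarith [hwz (n + 1) n (hw n.le_succ)]
  have := norm_le_norm_sub_add (∑ i ∈ Finset.range n, (w i : ℂ) * (z (i + 1) - z i)) (w n * z n)
  linarith [hz' n]

lemma norm_one_sub_eF_sub_one_div_le {θ : ℝ} (hθ : θ ≠ 0) :
    ‖1 - (eF θ - 1) / (2 * Real.pi * Complex.I * θ)‖ ≤ 4 * Real.pi * |θ| := by
  have hpi := Real.pi_pos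
  set u : ℂ := 2 * Real.pi * Complex.I * θ with hu
  have hnorm : ‖u‖ = 2 * Real.pi * |θ| := by
    simp [hu, abs_of_pos hpi]
  have hpos : 0 < ‖u‖ := by rw [hnorm]; positivity
  have hu0 : u ≠ 0 := norm_pos_iff.1 hpos
  rw [show 4 * Real.pi * |θ| = 2 * ‖u‖ by rw [hnorm]; ring]
  rcases le_or_gt ‖u‖ 1 with h | h
  · have h1 := Complex.norm_exp_sub_one_sub_id_le h
    have e : 1 - (eF θ - 1) / u = -((Complex.exp u - 1 - u) / u) := by
      rw [eF, ← hu]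
      field_simp
      ring
    rw [e, norm_neg, norm_div, div_le_iff₀ hpos]
    nlinarith
  · have h1 : ‖(eF θ - 1) / u‖ ≤ 1 := by
      rw [norm_div, div_le_one hpos, hnorm]
      exact norm_eF_sub_one_le θ
    refine (norm_sub_le _ _).trans ?_
    rw [norm_one]
    linarith

/-- The bound for the Weyl sum near zero. -/
lemma norm_sum_eF_pow_le {k : ℕ} (hk : 1 ≤ k) {β X : ℝ} (hX : 0 < X) (hβ : |β| * X ^ k = 1)
    (M : ℕ) :
    ‖∑ x ∈ Finset.range M, eF (β * (x : ℝ) ^ k)‖ ≤ 1 + 2 * X + 4 * Real.pi * |β| * M ^ k := by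
  have hpi := Real.pi_pos
  have hβ0 : β ≠ 0 := by
    rintro rfl
    simp at hβ
  have hβpos : 0 < |β| := abs_pos.2 hβ0
  set A := ⌈X⌉₊
  have hA1 : X ≤ A := Nat.le_ceil X
  have hA2 : (A : ℝ) < X + 1 := Nat.ceil_lt_add_one hX.le
  have htriv : ∀ n : ℕ, ‖∑ x ∈ Finset.range n, eF (β * (x : ℝ) ^ k)‖ ≤ n := fun n =>
    (norm_sum_le _ _).trans (by simp)
  rcases le_or_gt M A with hMA | hMA
  · have h1 : (M : ℝ) ≤ A := by exact_mod_cast hMA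
    have h2 : 0 ≤ 4 * Real.pi * |β| * M ^ k := by positivity
    linarith [htriv M]
  obtain ⟨B, rfl⟩ : ∃ B, M = A + B := ⟨M - A, by omega⟩
  rw [Finset.sum_range_add]
  set τ : ℕ → ℝ := fun i => ((A + (i + 1) : ℕ) : ℝ) ^ k - ((A + i : ℕ) : ℝ) ^ k with hτ
  have hτsum : ∀ i, τ i = ∑ j ∈ Finset.range k,
      ((A + (i + 1) : ℕ) : ℝ) ^ j * ((A + i : ℕ) : ℝ) ^ (k - 1 - j) := fun i => by
    have h := geom_sum₂_mul ((A + (i + 1) : ℕ) : ℝ) ((A + i : ℕ) : ℝ) k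
    rw [show ((A + (i + 1) : ℕ) : ℝ) - ((A + i : ℕ) : ℝ) = 1 by push_cast; ring, mul_one] at h
    exact h.symm
  have hmono : Monotone τ := fun i j hij => by
    rw [hτsum, hτsum]
    gcongr
  have hτ0 : X ^ (k - 1) ≤ τ 0 := by
    rw [hτsum]
    refine le_trans ?_ (Finset.single_le_sum (fun j _ => by positivity)
      (Finset.mem_range.2 hk : 0 ∈ Finset.range k))
    simp only [pow_zero, one_mul, add_zero, Nat.sub_zero]
    gcongr
  have hτpos : ∀ i, 0 < τ i := fun i =>
    lt_of_lt_of_le (by positivity) (hτ0.trans (hmono (Nat.zero_le i)))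
  set z : ℕ → ℂ := fun i => eF (β * ((A + i : ℕ) : ℝ) ^ k) with hz
  have hzsucc : ∀ i, z (i + 1) = z i * eF (β * τ i) := fun i => by
    rw [hz, hτ]
    simp only
    rw [← eF_add]
    ring_nf
  have habel := norm_sum_mul_sub_le (w := fun i => (τ i)⁻¹) (z := z)
    (fun i j hij => inv_anti₀ (hτpos i) (hmono hij)) (fun i => (inv_pos.2 (hτpos i)).le)
    (fun i => (norm_eF _).le) B
  set c : ℂ := (2 * Real.pi * Complex.I * β)⁻¹ with hc
  have hcnorm : ‖c‖ = (2 * Real.pi * |β|)⁻¹ := by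
    simp [hc, abs_of_pos hpi]
  have hsplit : ∑ i ∈ Finset.range B, z i =
      c * ∑ i ∈ Finset.range B, (((τ i)⁻¹ : ℝ) : ℂ) * (z (i + 1) - z i) +
      ∑ i ∈ Finset.range B, z i *
        (1 - (eF (β * τ i) - 1) / (2 * Real.pi * Complex.I * (β * τ i : ℝ))) := by
    rw [Finset.mul_sum, ← Finset.sum_add_distrib]
    refine Finset.sum_congr rfl fun i _ => ?_
    rw [hzsucc, hc]
    have h1 : (τ i : ℂ) ≠ 0 := by exact_mod_cast (hτpos i).ne'
    have h2 : (β : ℂ) ≠ 0 := by exact_mod_cast hβ0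
    have h3 : (Real.pi : ℂ) ≠ 0 := by exact_mod_cast hpi.ne'
    push_cast
    field_simp
    ring
  have hmain : ‖c * ∑ i ∈ Finset.range B, (((τ i)⁻¹ : ℝ) : ℂ) * (z (i + 1) - z i)‖ ≤ X := by
    rw [norm_mul, hcnorm]
    have h1 : (τ 0)⁻¹ ≤ |β| * X := by
      rw [inv_le_comm₀ (hτpos 0) (by positivity)]
      refine le_trans (inv_eq_of_mul_eq_one_right ?_).le hτ0
      rw [mul_assoc, ← pow_succ', Nat.sub_add_cancel hk, hβ]
    calc (2 * Real.pi * |β|)⁻¹ * ‖∑ i ∈ Finset.range B, (((τ i)⁻¹ : ℝ) : ℂ) * (z (i + 1) - z i)‖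
        ≤ (2 * Real.pi * |β|)⁻¹ * (2 * (|β| * X)) := by
          gcongr
          exact habel.trans (by linarith)
      _ = X / Real.pi := by field_simp
      _ ≤ X := div_le_self hX.le (by linarith [Real.pi_gt_three])
  have herr : ‖∑ i ∈ Finset.range B, z i *
      (1 - (eF (β * τ i) - 1) / (2 * Real.pi * Complex.I * (β * τ i : ℝ)))‖ ≤
      4 * Real.pi * |β| * ((A + B : ℕ) : ℝ) ^ k := by
    refine (norm_sum_le_of_le _ (f := fun i => z i *
      (1 - (eF (β * τ i) - 1) / (2 * Real.pi * Complex.I * (β * τ i : ℝ))))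
      (n := fun i => 4 * Real.pi * |β| * τ i) fun i _ => ?_).trans ?_
    · rw [norm_mul, hz, norm_eF, one_mul]
      refine (norm_one_sub_eF_sub_one_div_le (mul_ne_zero hβ0 (hτpos i).ne')).trans_eq ?_
      rw [abs_mul, abs_of_pos (hτpos i)]
      ring
    · rw [← Finset.mul_sum, Finset.sum_range_sub (fun i => ((A + i : ℕ) : ℝ) ^ k)]
      gcongr
      linarith [show (0 : ℝ) ≤ ((A + 0 : ℕ) : ℝ) ^ k by positivity]
  refine (norm_add_le _ _).trans ?_
  have h2 : ‖∑ i ∈ Finset.range B, z i‖ ≤ X + 4 * Real.pi * |β| * ((A + B : ℕ) : ℝ) ^ k := by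
    rw [hsplit]
    exact (norm_add_le _ _).trans (add_le_add hmain herr)
  linarith [htriv A]

lemma eF_div_congr {q : ℕ} {m n : ℤ} (h : m ≡ n [ZMOD q]) :
    eF ((m : ℝ) / q) = eF ((n : ℝ) / q) := by
  obtain ⟨c, hc⟩ := h.symm.dvd
  rcases Nat.eq_zero_or_pos q with rfl | hq
  · simp
  have hq' : (q : ℝ) ≠ 0 := by positivity
  have : (m : ℝ) / q = n / q + c := by
    have : (m : ℝ) - n = q * c := by exact_mod_cast hc
    field_simp
    linarith
  rw [this, eF_add_intCast]

/-- The complete exponential sum `∑ e(a r ^ k / q)` over residues modulo `q`. -/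
noncomputable def powSum (k q : ℕ) (a : ℤ) : ℂ :=
  ∑ r ∈ Finset.range q, eF (((a * (r : ℤ) ^ k : ℤ) : ℝ) / q)

lemma sum_range_mul {E : Type*} [AddCommMonoid E] (f : ℕ → E) (q M : ℕ) :
    ∑ x ∈ Finset.range (q * M), f x =
      ∑ j ∈ Finset.range M, ∑ r ∈ Finset.range q, f (q * j + r) := by
  induction M with
  | zero => simp
  | succ M ih => rw [mul_add_one, Finset.sum_range_add, ih, Finset.sum_range_succ]

/-- The major arc approximation of a Weyl sum. -/
lemma norm_weyl_sum_sub_le {k q N : ℕ} (hq : 1 ≤ q) (a : ℤ) (β : ℝ) :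
    ‖∑ x ∈ Finset.range N, eF ((a / q + β) * (x : ℝ) ^ k) -
      powSum k q a * ∑ j ∈ Finset.range (N / q), eF (β * q ^ k * (j : ℝ) ^ k)‖ ≤
      q + 2 * Real.pi * q * |β| * N ^ k := by
  have hpi := Real.pi_pos
  have hq0 : (q : ℝ) ≠ 0 := by positivity
  set M := N / q
  conv_lhs => rw [← Nat.div_add_mod N q]
  rw [Finset.sum_range_add, sum_range_mul, powSum, Finset.mul_sum, add_sub_right_comm,
    ← Finset.sum_sub_distrib]
  refine (norm_add_le _ _).trans ?_
  rw [add_comm]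
  refine add_le_add ?_ ?_
  · refine (norm_sum_le _ _).trans ?_
    simp only [norm_eF, Finset.sum_const, Finset.card_range, nsmul_eq_mul, mul_one]
    exact_mod_cast (Nat.mod_lt N hq).le
  · have hterm : ∀ j ∈ Finset.range M,
        ‖∑ r ∈ Finset.range q, eF ((a / q + β) * ((q * j + r : ℕ) : ℝ) ^ k) -
          (∑ r ∈ Finset.range q, eF (((a * (r : ℤ) ^ k : ℤ) : ℝ) / q)) *
            eF (β * q ^ k * (j : ℝ) ^ k)‖ ≤
        2 * Real.pi * q * |β| * (((q * (j + 1) : ℕ) : ℝ) ^ k - ((q * j : ℕ) : ℝ) ^ k) := by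
      intro j _
      rw [Finset.sum_mul, ← Finset.sum_sub_distrib]
      refine (norm_sum_le_of_le _ (n := fun _ => 2 * Real.pi * (|β| *
        (((q * (j + 1) : ℕ) : ℝ) ^ k - ((q * j : ℕ) : ℝ) ^ k))) fun r hr => ?_).trans_eq ?_
      · have hr := (Finset.mem_range.1 hr).le
        have e1 : eF ((a / q + β) * ((q * j + r : ℕ) : ℝ) ^ k) =
            eF (((a * (r : ℤ) ^ k : ℤ) : ℝ) / q) * eF (β * ((q * j + r : ℕ) : ℝ) ^ k) := by
          have hmod : a * ((q * j + r : ℕ) : ℤ) ^ k ≡ a * (r : ℤ) ^ k [ZMOD q] := by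
            refine Int.ModEq.mul_left _ (Int.ModEq.pow _ ?_)
            push_cast
            exact Int.modEq_iff_dvd.2 ⟨-j, by ring⟩
          rw [← eF_div_congr hmod, ← eF_add]
          push_cast
          ring_nf
        rw [e1, ← mul_sub, norm_mul, norm_eF, one_mul]
        refine (norm_eF_sub_eF_le _ _).trans ?_
        rw [show β * ((q * j + r : ℕ) : ℝ) ^ k - β * q ^ k * (j : ℝ) ^ k =
          β * (((q * j + r : ℕ) : ℝ) ^ k - ((q * j : ℕ) : ℝ) ^ k) by push_cast; ring, abs_mul,
          abs_of_nonneg (sub_nonneg.2 (by gcongr; omega))]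
        gcongr
        rw [mul_add_one]
        omega
      · rw [Finset.sum_const, Finset.card_range, nsmul_eq_mul]
        ring
    refine (norm_sum_le_of_le _ hterm).trans ?_
    rw [← Finset.mul_sum, Finset.sum_range_sub (fun j => ((q * j : ℕ) : ℝ) ^ k)]
    gcongr
    have h1 : ((q * M : ℕ) : ℝ) ^ k ≤ (N : ℝ) ^ k := by
      gcongr
      exact Nat.mul_div_le N q
    linarith [show (0 : ℝ) ≤ ((q * 0 : ℕ) : ℝ) ^ k by positivity]

lemma sum_range_add_of_periodic {g : ℕ → ℂ} {q : ℕ} (hg : Function.Periodic g q) (t : ℕ) :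
    ∑ r ∈ Finset.range q, g (r + t) = ∑ r ∈ Finset.range q, g r := by
  induction t with
  | zero => rfl
  | succ t ih =>
    have h1 := Finset.sum_range_succ' (fun r => g (r + t)) q
    rw [Finset.sum_range_succ] at h1
    simp only [zero_add] at h1
    rw [add_comm q t, hg t, add_left_inj, ih] at h1
    rw [h1]
    exact Finset.sum_congr rfl fun r _ => by rw [add_assoc, add_comm 1 t]

lemma sum_range_mul_of_coprime {g₁ g₂ : ℕ → ℂ} {m n : ℕ} (hm : m ≠ 0) (hn : n ≠ 0)
    (hmn : m.Coprime n) (h₁ : Function.Periodic g₁ m) (h₂ : Function.Periodic g₂ n) :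
    ∑ x ∈ Finset.range (m * n), g₁ x * g₂ x =
      (∑ x ∈ Finset.range m, g₁ x) * ∑ x ∈ Finset.range n, g₂ x := by
  rw [Finset.sum_mul_sum, ← Finset.sum_product']
  refine Finset.sum_nbij' (fun x => (x % m, x % n))
    (fun y => (Nat.chineseRemainder hmn y.1 y.2 : ℕ)) ?_ ?_ ?_ ?_ ?_
  · intro x _
    simp [Nat.mod_lt _ (Nat.pos_of_ne_zero hm), Nat.mod_lt _ (Nat.pos_of_ne_zero hn)]
  · intro y _
    exact Finset.mem_range.2 (Nat.chineseRemainder_lt_mul hmn _ _ hm hn)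
  · intro x hx
    have h : x ≡ Nat.chineseRemainder hmn (x % m) (x % n) [MOD m * n] :=
      Nat.chineseRemainder_modEq_unique hmn (Nat.mod_modEq x m).symm (Nat.mod_modEq x n).symm
    exact (h.eq_of_lt_of_lt (Finset.mem_range.1 hx)
      (Nat.chineseRemainder_lt_mul hmn _ _ hm hn)).symm
  · rintro ⟨a, b⟩ hab
    simp only [Finset.mem_product, Finset.mem_range] at hab
    have h := (Nat.chineseRemainder hmn a b).2
    refine Prod.ext ?_ ?_
    · exact Eq.trans h.1 (Nat.mod_eq_of_lt hab.1)
    · exact Eq.trans h.2 (Nat.mod_eq_of_lt hab.2)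
  · intro x _
    simp only
    rw [h₁.map_mod_nat, h₂.map_mod_nat]

lemma periodic_eF_div (k q : ℕ) (a : ℤ) :
    Function.Periodic (fun r : ℕ => eF (((a * (r : ℤ) ^ k : ℤ) : ℝ) / q)) q := by
  intro r
  refine eF_div_congr (Int.ModEq.mul_left _ (Int.ModEq.pow _ ?_))
  push_cast
  exact Int.add_modEq_right

lemma norm_powSum_le (k q : ℕ) (a : ℤ) : ‖powSum k q a‖ ≤ q :=
  (norm_sum_le _ _).trans (by simp)

lemma exists_powSum_mul {k m n : ℕ} (hm : m ≠ 0) (hn : n ≠ 0) (hmn : m.Coprime n) {a : ℤ}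
    (ha : IsCoprime a (m * n : ℕ)) : ∃ u v : ℤ, IsCoprime u m ∧ IsCoprime v n ∧
      powSum k (m * n) a = powSum k m u * powSum k n v := by
  obtain ⟨s, t, hst⟩ := Nat.isCoprime_iff_coprime.2 hmn
  push_cast at ha
  have ham := ha.of_mul_right_left
  have han := ha.of_mul_right_right
  refine ⟨a * t, a * s, ham.mul_left ⟨n, s, by linarith⟩, han.mul_left ⟨m, t, by linarith⟩, ?_⟩
  rw [powSum, powSum, powSum, ← sum_range_mul_of_coprime hm hn hmn (periodic_eF_div k m _)
    (periodic_eF_div k n _)]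
  refine Finset.sum_congr rfl fun x _ => ?_
  rw [← eF_add]
  congr 1
  have h1 : (s : ℝ) * m + t * n = 1 := by exact_mod_cast hst
  have hm' : (m : ℝ) ≠ 0 := by exact_mod_cast hm
  have hn' : (n : ℝ) ≠ 0 := by exact_mod_cast hn
  push_cast
  field_simp
  linear_combination (-(a : ℝ) * x ^ k) * h1

lemma sum_eF_mul_div {p : ℕ} (hp : p ≠ 0) (c : ℤ) :
    ∑ z ∈ Finset.range p, eF (((c * z : ℤ) : ℝ) / p) = if (p : ℤ) ∣ c then (p : ℂ) else 0 := by
  have hp' : (p : ℝ) ≠ 0 := by exact_mod_cast hp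
  have hterm : ∀ z : ℕ, eF (((c * z : ℤ) : ℝ) / p) = eF ((c : ℝ) / p) ^ z := fun z => by
    rw [← eF_natCast_mul]
    push_cast
    ring_nf
  simp only [hterm]
  split_ifs with h
  · obtain ⟨d, rfl⟩ := h
    have : (((p * d : ℤ) : ℤ) : ℝ) / p = d := by
      push_cast
      field_simp
    rw [this, eF_intCast]
    simp
  · have h1 := mul_neg_geom_sum (eF ((c : ℝ) / p)) p
    rw [← eF_natCast_mul, mul_div_cancel₀ _ hp', eF_intCast, sub_self] at h1
    refine (mul_eq_zero.1 h1).resolve_left fun h2 => h ?_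
    have h3 := four_mul_abs_sub_round_le ((c : ℝ) / p)
    rw [norm_sub_rev, h2, norm_zero] at h3
    have h4 : |(c : ℝ) / p - round ((c : ℝ) / p)| = 0 :=
      le_antisymm (by linarith) (abs_nonneg _)
    rw [abs_eq_zero, sub_eq_zero, div_eq_iff hp'] at h4
    refine ⟨round ((c : ℝ) / p), ?_⟩
    rw [mul_comm]
    exact_mod_cast h4

/-- Only multiples of `p` contribute to the complete sum modulo a high power of `p`. -/
lemma powSum_prime_pow {k p s k' m : ℕ} (hp : p.Prime) (hk : 2 ≤ k) (hk' : k = p ^ s * k')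
    (hpk' : ¬ p ∣ k') (hm : 2 * s + 2 ≤ m) {a : ℤ} (ha : IsCoprime a p) :
    powSum k (p ^ m) a =
      ∑ w ∈ Finset.range (p ^ (m - 1)),
        eF (((a * ((p * w : ℕ) : ℤ) ^ k : ℤ) : ℝ) / (p ^ m : ℕ)) := by
  have hp0 : p ≠ 0 := hp.ne_zero
  have hpZ : Prime (p : ℤ) := Nat.prime_iff_prime_int.1 hp
  set g : ℕ → ℂ := fun r => eF (((a * (r : ℤ) ^ k : ℤ) : ℝ) / (p ^ m : ℕ)) with hg
  have hper : Function.Periodic g (p ^ m) := periodic_eF_div k (p ^ m) a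
  have hshift : ∀ r z : ℕ, g (r + p ^ (m - s - 1) * z) =
      g r * eF (((a * k' * (r : ℤ) ^ (k - 1) * z : ℤ) : ℝ) / p) := by
    intro r z
    obtain ⟨e, he⟩ := Polynomial.powAddExpansion (r : ℤ) ((p : ℤ) ^ (m - s - 1) * z) k
    have hmod : a * ((r + p ^ (m - s - 1) * z : ℕ) : ℤ) ^ k ≡
        a * (r : ℤ) ^ k + p ^ (m - 1) * (a * k' * (r : ℤ) ^ (k - 1) * z) [ZMOD (p ^ m : ℕ)] := by
      have h1 : (k : ℤ) = p ^ s * k' := by exact_mod_cast hk'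
      have h2 : (p : ℤ) ^ s * p ^ (m - s - 1) = p ^ (m - 1) := by
        rw [← pow_add]
        congr 1
        omega
      have h3 : (p : ℤ) ^ (m - s - 1) * p ^ (m - s - 1) = p ^ m * p ^ (m - 2 * s - 2) := by
        rw [← pow_add, ← pow_add]
        congr 1
        omega
      refine (Int.modEq_iff_dvd.2 ⟨a * e * z ^ 2 * p ^ (m - 2 * s - 2), ?_⟩).symm
      push_cast
      rw [he, h1]
      linear_combination (a * k' * (r : ℤ) ^ (k - 1) * z) * h2 + a * e * z ^ 2 * h3
    rw [hg]
    simp only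
    rw [eF_div_congr hmod, ← eF_add]
    congr 1
    have h4 : (p : ℝ) ^ m = p ^ (m - 1) * p := by
      rw [← pow_succ]
      congr 1
      omega
    push_cast
    rw [h4]
    have hp' : (p : ℝ) ≠ 0 := by exact_mod_cast hp0
    field_simp
  have hdvd : ∀ r : ℕ, (p : ℤ) ∣ a * k' * (r : ℤ) ^ (k - 1) ↔ p ∣ r := by
    intro r
    constructor
    · intro h
      rcases hpZ.dvd_or_dvd h with h | h
      · rcases hpZ.dvd_or_dvd h with h | h
        · exact absurd (ha.symm.isUnit_of_dvd' dvd_rfl h) hpZ.not_isUnit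
        · exact absurd (Int.natCast_dvd_natCast.1 h) hpk'
      · exact Int.natCast_dvd_natCast.1 (hpZ.dvd_of_dvd_pow h)
    · intro h
      exact ((Int.natCast_dvd_natCast.2 h).trans (dvd_pow_self _ (by omega))).mul_left _
  have hmul : (p : ℂ) * powSum k (p ^ m) a =
      p * ∑ r ∈ Finset.range (p ^ m), if p ∣ r then g r else 0 := by
    calc (p : ℂ) * powSum k (p ^ m) a = ∑ z ∈ Finset.range p, ∑ r ∈ Finset.range (p ^ m), g r := by
          rw [Finset.sum_const, Finset.card_range, nsmul_eq_mul]
          rfl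
      _ = ∑ z ∈ Finset.range p, ∑ r ∈ Finset.range (p ^ m), g (r + p ^ (m - s - 1) * z) :=
          Finset.sum_congr rfl fun z _ => (sum_range_add_of_periodic hper _).symm
      _ = ∑ r ∈ Finset.range (p ^ m), p * (if p ∣ r then g r else 0) := by
          rw [Finset.sum_comm]
          refine Finset.sum_congr rfl fun r _ => ?_
          simp only [hshift]
          rw [← Finset.mul_sum, sum_eF_mul_div hp0]
          simp only [hdvd]
          split_ifs <;> ring
      _ = _ := by rw [Finset.mul_sum]
  rw [mul_left_cancel₀ (Nat.cast_ne_zero.2 hp0) hmul]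
  conv_lhs => rw [show p ^ m = p * p ^ (m - 1) by rw [← pow_succ']; congr 1; omega]
  rw [sum_range_mul]
  refine Finset.sum_congr rfl fun w _ => ?_
  rw [Finset.sum_eq_single_of_mem 0 (Finset.mem_range.2 hp.pos)]
  · rw [add_zero, if_pos (dvd_mul_right _ _)]
  · intro r hr hr0
    rw [if_neg]
    rw [Nat.dvd_add_right (dvd_mul_right _ _)]
    exact fun h => hr0 (Nat.eq_zero_of_dvd_of_lt h (Finset.mem_range.1 hr))

lemma powSum_prime_pow_of_le {k p s k' m : ℕ} (hp : p.Prime) (hk : 2 ≤ k) (hk' : k = p ^ s * k')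
    (hpk' : ¬ p ∣ k') (hm : 2 * s + 2 ≤ m) (hmk : m ≤ k) {a : ℤ} (ha : IsCoprime a p) :
    powSum k (p ^ m) a = (p : ℂ) ^ (m - 1) := by
  rw [powSum_prime_pow hp hk hk' hpk' hm ha]
  have hterm : ∀ w ∈ Finset.range (p ^ (m - 1)),
      eF (((a * ((p * w : ℕ) : ℤ) ^ k : ℤ) : ℝ) / (p ^ m : ℕ)) = 1 := by
    intro w _
    rw [eF_div_congr (n := 0) (Int.modEq_zero_iff_dvd.2 ?_)]
    · simp
    · push_cast
      rw [mul_pow]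
      exact ((pow_dvd_pow _ hmk).mul_right _).mul_left _
  rw [Finset.sum_congr rfl hterm]
  simp

lemma powSum_prime_pow_of_lt {k p s k' m : ℕ} (hp : p.Prime) (hk : 2 ≤ k) (hk' : k = p ^ s * k')
    (hpk' : ¬ p ∣ k') (hm : 2 * s + 2 ≤ m) (hmk : k < m) {a : ℤ} (ha : IsCoprime a p) :
    powSum k (p ^ m) a = (p : ℂ) ^ (k - 1) * powSum k (p ^ (m - k)) a := by
  rw [powSum_prime_pow hp hk hk' hpk' hm ha]
  have hp' : (p : ℝ) ≠ 0 := by exact_mod_cast hp.ne_zero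
  have hterm : ∀ w : ℕ, eF (((a * ((p * w : ℕ) : ℤ) ^ k : ℤ) : ℝ) / (p ^ m : ℕ)) =
      eF (((a * (w : ℤ) ^ k : ℤ) : ℝ) / (p ^ (m - k) : ℕ)) := by
    intro w
    have : (p : ℝ) ^ m = p ^ (m - k) * p ^ k := by
      rw [← pow_add, Nat.sub_add_cancel hmk.le]
    congr 1
    push_cast
    rw [this, mul_pow]
    field_simp
  simp only [hterm]
  conv_lhs => rw [show p ^ (m - 1) = p ^ (m - k) * p ^ (k - 1) by rw [← pow_add]; congr 1; omega]
  rw [sum_range_mul]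
  have hper := periodic_eF_div k (p ^ (m - k)) a
  have : ∀ j ∈ Finset.range (p ^ (k - 1)), ∑ r ∈ Finset.range (p ^ (m - k)),
      eF (((a * ((p ^ (m - k) * j + r : ℕ) : ℤ) ^ k : ℤ) : ℝ) / (p ^ (m - k) : ℕ)) =
      powSum k (p ^ (m - k)) a := by
    intro j _
    rw [powSum, ← sum_range_add_of_periodic hper (p ^ (m - k) * j)]
    exact Finset.sum_congr rfl fun r _ => by rw [add_comm]
  rw [Finset.sum_congr rfl this]
  simp

lemma powSum_eq_sum_zmod (k p : ℕ) [NeZero p] (a : ℤ) :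
    powSum k p a = ∑ x : ZMod p, ZMod.stdAddChar ((a : ZMod p) * x ^ k) := by
  rw [powSum]
  refine Finset.sum_nbij' (fun r => (r : ZMod p)) ZMod.val (fun _ _ => Finset.mem_univ _)
    (fun x _ => Finset.mem_range.2 x.val_lt)
    (fun r hr => ZMod.val_cast_of_lt (Finset.mem_range.1 hr))
    (fun x _ => ZMod.natCast_zmod_val x) fun r _ => ?_
  have : (a : ZMod p) * (r : ZMod p) ^ k = ((a * (r : ℤ) ^ k : ℤ) : ZMod p) := by push_cast; rfl
  rw [this, ZMod.stdAddChar_coe, eF]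
  congr 1
  push_cast
  ring

lemma norm_sq_sum_addChar {p : ℕ} [NeZero p] (k : ℕ) (b : ZMod p) :
    ((‖∑ x : ZMod p, (ZMod.stdAddChar (b * x ^ k) : ℂ)‖ ^ 2 : ℝ) : ℂ) =
      ∑ x : ZMod p, ∑ y : ZMod p, ZMod.stdAddChar (b * (x ^ k - y ^ k)) := by
  push_cast
  rw [← Complex.mul_conj', map_sum, Finset.sum_mul_sum]
  refine Finset.sum_congr rfl fun x _ => Finset.sum_congr rfl fun y _ => ?_
  rw [← AddChar.map_neg_eq_conj, ← AddChar.map_add_eq_mul]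
  congr 1
  ring

lemma card_pow_eq_le {F : Type*} [Field F] [Fintype F] [DecidableEq F] {k : ℕ} (hk : 1 ≤ k)
    (c : F) : (Finset.univ.filter fun x : F => x ^ k = c).card ≤ k := by
  have hsub : (Finset.univ.filter fun x : F => x ^ k = c) ⊆
      (Polynomial.nthRoots k c).toFinset := by
    intro x hx
    rw [Multiset.mem_toFinset, Polynomial.mem_nthRoots hk]
    exact (Finset.mem_filter.1 hx).2
  exact (Finset.card_le_card hsub).trans
    ((Multiset.toFinset_card_le _).trans (Polynomial.card_nthRoots k c))

/-- The second moment bound for complete sums to a prime modulus. -/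
lemma sum_norm_sq_sum_addChar_le {p k : ℕ} [Fact p.Prime] (hk : 1 ≤ k) :
    ∑ b : ZMod p, ‖∑ x : ZMod p, (ZMod.stdAddChar (b * x ^ k) : ℂ)‖ ^ 2 ≤ (k : ℝ) * p ^ 2 := by
  classical
  have h1 : ((∑ b : ZMod p, ‖∑ x : ZMod p, (ZMod.stdAddChar (b * x ^ k) : ℂ)‖ ^ 2 : ℝ) : ℂ) =
      ((∑ y : ZMod p, p * (Finset.univ.filter fun x : ZMod p => x ^ k = y ^ k).card : ℕ) : ℂ) := by
    rw [Complex.ofReal_sum, Finset.sum_congr rfl fun b _ => norm_sq_sum_addChar k b,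
      Finset.sum_comm]
    rw [Finset.sum_congr rfl fun x _ => Finset.sum_comm, Finset.sum_comm]
    push_cast
    refine Finset.sum_congr rfl fun y _ => ?_
    rw [Finset.card_filter, Nat.cast_sum, Finset.mul_sum]
    refine Finset.sum_congr rfl fun x _ => ?_
    rw [AddChar.sum_mulShift _ (ZMod.isPrimitive_stdAddChar p), ZMod.card]
    simp only [sub_eq_zero]
    split_ifs <;> simp
  have h2 := Complex.ofReal_injective (h1.trans (Complex.ofReal_natCast _).symm)
  rw [h2]
  have h3 : ∑ y : ZMod p, p * (Finset.univ.filter fun x : ZMod p => x ^ k = y ^ k).card ≤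
      k * p ^ 2 := by
    refine (Finset.sum_le_card_nsmul _ _ (p * k) fun y _ =>
      Nat.mul_le_mul_left _ (card_pow_eq_le hk _)).trans_eq ?_
    rw [Finset.card_univ, ZMod.card, smul_eq_mul]
    ring
  exact_mod_cast h3

lemma norm_powSum_prime_sq_le {p k : ℕ} (hp : p.Prime) (hk : 1 ≤ k) {a : ℤ}
    (ha : IsCoprime a p) : ‖powSum k p a‖ ^ 2 ≤ 2 * (k : ℝ) ^ 2 * p := by
  classical
  have : Fact p.Prime := ⟨hp⟩
  rw [powSum_eq_sum_zmod]
  set S : ZMod p → ℝ := fun b => ‖∑ x : ZMod p, (ZMod.stdAddChar (b * x ^ k) : ℂ)‖ ^ 2 with hS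
  have ha0 : (a : ZMod p) ≠ 0 := by
    rw [Ne, ZMod.intCast_zmod_eq_zero_iff_dvd]
    exact fun h => (Nat.prime_iff_prime_int.1 hp).not_isUnit (ha.symm.isUnit_of_dvd' dvd_rfl h)
  set T : Finset (ZMod p) := Finset.univ.erase 0
  have hinv : ∀ t ∈ T, S (a * t ^ k) = S a := by
    intro t ht
    have ht0 : t ≠ 0 := Finset.ne_of_mem_erase ht
    simp only [hS]
    congr 2
    refine Fintype.sum_equiv (Equiv.mulLeft₀ t ht0) _ _ fun x => ?_
    change _ = ZMod.stdAddChar ((a : ZMod p) * (t * x) ^ k)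
    rw [mul_pow, mul_assoc]
  have hcardT : (T.card : ℝ) = p - 1 := by
    rw [Finset.card_erase_of_mem (Finset.mem_univ _), Finset.card_univ, ZMod.card,
      Nat.cast_sub hp.one_le, Nat.cast_one]
  have h1 : (p - 1 : ℝ) * S a ≤ k * ∑ b : ZMod p, S b := by
    calc (p - 1 : ℝ) * S a = ∑ t ∈ T, S (a * t ^ k) := by
          rw [Finset.sum_congr rfl hinv, Finset.sum_const, nsmul_eq_mul, hcardT]
      _ = ∑ b : ZMod p, ∑ t ∈ T with a * t ^ k = b, S (a * t ^ k) :=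
          (Finset.sum_fiberwise _ _ _).symm
      _ ≤ ∑ b : ZMod p, k * S b := by
          refine Finset.sum_le_sum fun b _ => ?_
          rw [Finset.sum_congr rfl fun t ht => by rw [(Finset.mem_filter.1 ht).2],
            Finset.sum_const, nsmul_eq_mul]
          refine mul_le_mul_of_nonneg_right ?_ (by positivity)
          have hsub : T.filter (fun t => a * t ^ k = b) ⊆
              Finset.univ.filter fun t : ZMod p => t ^ k = (a : ZMod p)⁻¹ * b := by
            intro t ht
            rw [Finset.mem_filter] at ht ⊢
            refine ⟨Finset.mem_univ _, ?_⟩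
            rw [← ht.2, inv_mul_cancel_left₀ ha0]
          exact_mod_cast (Finset.card_le_card hsub).trans (card_pow_eq_le hk _)
      _ = _ := by rw [Finset.mul_sum]
  have h2 : ∑ b : ZMod p, S b ≤ (k : ℝ) * p ^ 2 := sum_norm_sq_sum_addChar_le hk
  have hp2 : (2 : ℝ) ≤ p := by exact_mod_cast hp.two_le
  have hSa : 0 ≤ S a := by positivity
  change S a ≤ _
  have h3 : (p : ℝ) * S a ≤ p * (2 * (k : ℝ) ^ 2 * p) := by
    have h4 : (k : ℝ) * ∑ b : ZMod p, S b ≤ k * (k * p ^ 2) := by gcongr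
    nlinarith
  exact le_of_mul_le_mul_left h3 (by linarith)

lemma norm_powSum_two_prime_sq {p : ℕ} (hp : p.Prime) (hp2 : p ≠ 2) {a : ℤ}
    (ha : IsCoprime a p) : ‖powSum 2 p a‖ ^ 2 = p := by
  classical
  have : Fact p.Prime := ⟨hp⟩
  rw [powSum_eq_sum_zmod]
  have ha0 : (a : ZMod p) ≠ 0 := by
    rw [Ne, ZMod.intCast_zmod_eq_zero_iff_dvd]
    exact fun h => (Nat.prime_iff_prime_int.1 hp).not_isUnit (ha.symm.isUnit_of_dvd' dvd_rfl h)
  have h20 : (2 : ZMod p) ≠ 0 := by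
    have := (Nat.prime_dvd_prime_iff_eq hp Nat.prime_two).not.2 hp2
    rw [← ZMod.natCast_eq_zero_iff] at this
    exact_mod_cast this
  refine Complex.ofReal_injective ?_
  rw [norm_sq_sum_addChar, Finset.sum_comm]
  have hshift : ∀ y : ZMod p, ∑ x : ZMod p, (ZMod.stdAddChar ((a : ZMod p) * (x ^ 2 - y ^ 2)) : ℂ) =
      ∑ h : ZMod p, ZMod.stdAddChar ((a : ZMod p) * h ^ 2) *
        ZMod.stdAddChar (y * (2 * (a : ZMod p) * h)) := by
    intro y
    refine (Fintype.sum_equiv (Equiv.addRight y) _ _ fun h => ?_).symm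
    rw [← AddChar.map_add_eq_mul, Equiv.coe_addRight]
    congr 1
    ring
  rw [Finset.sum_congr rfl fun y _ => hshift y, Finset.sum_comm]
  simp only [← Finset.mul_sum]
  rw [Finset.sum_eq_single_of_mem 0 (Finset.mem_univ _)]
  · rw [AddChar.sum_mulShift _ (ZMod.isPrimitive_stdAddChar p), ZMod.card]
    simp
  · intro h _ hh
    rw [AddChar.sum_mulShift _ (ZMod.isPrimitive_stdAddChar p), if_neg]
    · simp
    · exact mul_ne_zero (mul_ne_zero h20 ha0) hh

lemma norm_powSum_prime_pow_le {p k : ℕ} (hp : p.Prime) (hk : 2 ≤ k) (hpk : 8 * k ^ 6 < p)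
    {a : ℤ} (ha : IsCoprime a p) : ‖powSum k p a‖ ^ k ≤ (p : ℝ) ^ (k - 1) := by
  obtain rfl | hk3 := hk.eq_or_lt
  · rw [norm_powSum_two_prime_sq hp (by omega) ha, pow_one]
  · have hk1 : (1 : ℝ) ≤ k := by exact_mod_cast (show 1 ≤ k by omega)
    have h1 : (1 : ℝ) ≤ 2 * (k : ℝ) ^ 2 := by nlinarith
    have h2 : (2 * (k : ℝ) ^ 2) ^ 3 ≤ p := by
      have : 8 * (k : ℝ) ^ 6 ≤ p := by exact_mod_cast hpk.le
      nlinarith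
    have h3 : (‖powSum k p a‖ ^ k) ^ 2 ≤ ((p : ℝ) ^ (k - 1)) ^ 2 := by
      calc (‖powSum k p a‖ ^ k) ^ 2 = (‖powSum k p a‖ ^ 2) ^ k := by
            rw [← pow_mul, ← pow_mul, mul_comm]
        _ ≤ (2 * (k : ℝ) ^ 2 * p) ^ k := by
          gcongr
          exact norm_powSum_prime_sq_le hp (by omega) ha
        _ = (2 * (k : ℝ) ^ 2) ^ k * (p : ℝ) ^ k := mul_pow _ _ _
        _ ≤ (2 * (k : ℝ) ^ 2) ^ (3 * (k - 2)) * (p : ℝ) ^ k := by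
          gcongr
          omega
        _ ≤ (p : ℝ) ^ (k - 2) * (p : ℝ) ^ k := by
          rw [pow_mul]
          gcongr
        _ = ((p : ℝ) ^ (k - 1)) ^ 2 := by
          rw [← pow_add, ← pow_mul]
          congr 1
          omega
    exact le_of_sq_le_sq h3 (by positivity)

/-- The loss at the prime `p` in the bound for complete sums of `k`th powers. -/
def localLoss (k p : ℕ) : ℕ := if p ≤ 8 * k ^ 6 then (p + 1) ^ (2 * k) else 1

lemma one_le_localLoss (k p : ℕ) : 1 ≤ localLoss k p := by
  unfold localLoss
  split_ifs
  · exact Nat.one_le_pow _ _ (Nat.succ_pos _)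
  · exact le_rfl

lemma norm_powSum_pow_le_of_prime_pow {p k : ℕ} (hp : p.Prime) (hk : 2 ≤ k) {a : ℤ}
    (ha : IsCoprime a p) (m : ℕ) :
    ‖powSum k (p ^ m) a‖ ^ k ≤ localLoss k p * ((p : ℝ) ^ m) ^ (k - 1) := by
  have hL : (1 : ℝ) ≤ localLoss k p := by exact_mod_cast one_le_localLoss k p
  have hp1 : (1 : ℝ) ≤ p := by exact_mod_cast hp.one_le
  obtain ⟨s, k', hpk', hkeq⟩ := Nat.exists_eq_pow_mul_and_not_dvd (by omega : k ≠ 0) p hp.ne_one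
  have hk'0 : k' ≠ 0 := by
    rintro rfl
    exact hpk' (dvd_zero p)
  have hsk : s < k := by
    calc s < p ^ s := Nat.lt_pow_self hp.one_lt
      _ ≤ p ^ s * k' := Nat.le_mul_of_pos_right _ (Nat.pos_of_ne_zero hk'0)
      _ = k := hkeq.symm
  induction m using Nat.strong_induction_on with
  | _ m ih =>
    by_cases hm : 2 * s + 2 ≤ m
    · obtain hmk | hmk := le_or_gt m k
      · rw [powSum_prime_pow_of_le hp hk hkeq hpk' hm hmk ha, norm_pow, Complex.norm_natCast]
        calc ((p : ℝ) ^ (m - 1)) ^ k = (p : ℝ) ^ ((m - 1) * k) := (pow_mul _ _ _).symm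
          _ ≤ (p : ℝ) ^ (m * (k - 1)) := by
            refine pow_le_pow_right₀ hp1 ?_
            rw [Nat.sub_mul, Nat.mul_sub]
            omega
          _ = 1 * ((p : ℝ) ^ m) ^ (k - 1) := by rw [one_mul, pow_mul]
          _ ≤ _ := by gcongr
      · rw [powSum_prime_pow_of_lt hp hk hkeq hpk' hm hmk ha, norm_mul, norm_pow,
          Complex.norm_natCast, mul_pow]
        calc ((p : ℝ) ^ (k - 1)) ^ k * ‖powSum k (p ^ (m - k)) a‖ ^ k
            ≤ ((p : ℝ) ^ (k - 1)) ^ k * (localLoss k p * ((p : ℝ) ^ (m - k)) ^ (k - 1)) := by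
              gcongr
              exact ih (m - k) (by omega)
          _ = localLoss k p * ((p : ℝ) ^ k * (p : ℝ) ^ (m - k)) ^ (k - 1) := by ring
          _ = _ := by rw [← pow_add, Nat.add_sub_cancel' hmk.le]
    · have htriv : ‖powSum k (p ^ m) a‖ ^ k ≤ (p : ℝ) ^ m * ((p : ℝ) ^ m) ^ (k - 1) := by
        rw [← pow_succ', Nat.sub_add_cancel (by omega)]
        gcongr
        exact_mod_cast norm_powSum_le k (p ^ m) a
      by_cases hpB : p ≤ 8 * k ^ 6
      · refine htriv.trans ?_
        gcongr
        rw [localLoss, if_pos hpB]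
        push_cast
        calc (p : ℝ) ^ m ≤ (p : ℝ) ^ (2 * k) := pow_le_pow_right₀ hp1 (by omega)
          _ ≤ ((p : ℝ) + 1) ^ (2 * k) := by
            gcongr
            linarith
      · obtain rfl | hm0 := Nat.eq_zero_or_pos m
        · refine htriv.trans ?_
          rw [pow_zero]
          gcongr
        · have hs0 : s = 0 := by
            by_contra hs
            have h1 : p ≤ k := by
              calc p ≤ p ^ s := Nat.le_self_pow hs p
                _ ≤ p ^ s * k' := Nat.le_mul_of_pos_right _ (Nat.pos_of_ne_zero hk'0)
                _ = k := hkeq.symm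
            have h2 : k ≤ k ^ 6 := Nat.le_self_pow (by norm_num) k
            omega
          obtain rfl : m = 1 := by omega
          rw [pow_one, pow_one]
          exact (norm_powSum_prime_pow_le hp hk (by omega) ha).trans
            (le_mul_of_one_le_left (by positivity) hL)

lemma norm_powSum_pow_le_prod {k : ℕ} (hk : 2 ≤ k) {q : ℕ} (hq : 1 ≤ q) {a : ℤ}
    (ha : IsCoprime a q) :
    ‖powSum k q a‖ ^ k ≤ (∏ p ∈ q.primeFactors, localLoss k p : ℕ) * (q : ℝ) ^ (k - 1) := by
  induction q using Nat.recOnPosPrimePosCoprime generalizing a with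
  | prime_pow p n hp hn =>
    rw [Nat.primeFactors_prime_pow hn.ne' hp, Finset.prod_singleton]
    push_cast
    refine norm_powSum_pow_le_of_prime_pow hp hk ?_ n
    push_cast at ha
    exact (IsCoprime.pow_right_iff hn).1 ha
  | zero => omega
  | one =>
    have := norm_powSum_le k 1 a
    simpa using pow_le_pow_left₀ (norm_nonneg _) this k
  | coprime m n hm hn hmn ihm ihn =>
    obtain ⟨u, v, hu, hv, huv⟩ := exists_powSum_mul (k := k) (by omega) (by omega) hmn ha
    rw [huv, norm_mul, mul_pow, hmn.primeFactors_mul,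
      Finset.prod_union hmn.disjoint_primeFactors]
    refine (mul_le_mul (ihm hm.le hu) (ihn hn.le hv) (by positivity) (by positivity)).trans_eq ?_
    push_cast
    ring

/-- The classical bound for complete sums of `k`th powers. -/
lemma exists_norm_powSum_pow_le {k : ℕ} (hk : 2 ≤ k) : ∃ C : ℝ, 1 ≤ C ∧ ∀ (q : ℕ) (a : ℤ),
    1 ≤ q → IsCoprime a q → ‖powSum k q a‖ ^ k ≤ C * (q : ℝ) ^ (k - 1) := by
  refine ⟨(∏ p ∈ Finset.range (8 * k ^ 6 + 1), localLoss k p : ℕ), ?_, fun q a hq ha =>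
    (norm_powSum_pow_le_prod hk hq ha).trans ?_⟩
  · exact_mod_cast Finset.one_le_prod' fun p _ => one_le_localLoss k p
  refine mul_le_mul_of_nonneg_right (Nat.cast_le.2 ?_) (by positivity)
  rw [← Finset.prod_filter_mul_prod_filter_not q.primeFactors (· ≤ 8 * k ^ 6),
    Finset.prod_eq_one (s := q.primeFactors.filter fun p => ¬ p ≤ 8 * k ^ 6)
      (f := localLoss k), mul_one]
  · refine Finset.prod_le_prod_of_subset_of_one_le' (fun p hp => ?_) fun p _ _ =>
      one_le_localLoss k p
    exact Finset.mem_range.2 (Nat.lt_succ_of_le (Finset.mem_filter.1 hp).2)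
  · intro p hp
    exact if_neg (Finset.mem_filter.1 hp).2

/-- Refining an approximation on a major arc by means of the local bound `hC`. -/
lemma mul_pow_le_of_major_arc {k : ℕ} (hk : 1 ≤ k) {C : ℝ}
    {N q : ℕ} {a : ℤ} {β T D : ℝ} (hC : ‖powSum k q a‖ ^ k ≤ C * (q : ℝ) ^ (k - 1))
    (hq : 1 ≤ q) (hqD : (q : ℝ) ≤ D) (hβ : q * |β| * N ^ k ≤ D)
    (hDT : 44 * D ≤ T)
    (hT : T ≤ ‖∑ x ∈ Finset.range N, eF ((a / q + β) * (x : ℝ) ^ k)‖) :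
    q * T ^ k ≤ C * (2 * N) ^ k ∧ q * |β| * T ^ k ≤ C * 4 ^ k := by
  have hq0 : (0 : ℝ) < q := by exact_mod_cast hq
  have hπ := Real.pi_lt_d2
  have hπ0 := Real.pi_pos
  set S := powSum k q a
  set V := ∑ j ∈ Finset.range (N / q), eF (β * q ^ k * (j : ℝ) ^ k)
  have hNq : ((N / q : ℕ) : ℝ) ≤ N / q := Nat.cast_div_le
  have hT0 : 0 ≤ T := by linarith
  have hβ0 : 0 ≤ q * |β| * (N : ℝ) ^ k := by positivity
  have hSV : T - 8 * D ≤ ‖S‖ * ‖V‖ := by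
    have h1 := norm_weyl_sum_sub_le (k := k) (N := N) hq a β
    have h2 := norm_sub_norm_le (∑ x ∈ Finset.range N, eF ((a / q + β) * (x : ℝ) ^ k)) (S * V)
    rw [norm_mul] at h2
    have h3 : (q : ℝ) + 2 * Real.pi * q * |β| * N ^ k ≤ 8 * D := by
      have : 2 * Real.pi * q * |β| * (N : ℝ) ^ k = 2 * Real.pi * (q * |β| * N ^ k) := by ring
      nlinarith
    linarith
  have hqk : (q : ℝ) * q ^ (k - 1) = q ^ k := by rw [← pow_succ', Nat.sub_add_cancel hk]
  constructor
  · have hV : ‖V‖ ≤ N / q := (norm_sum_le _ _).trans (by simpa using hNq)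
    have h1 : T ≤ ‖S‖ * (2 * N / q) := by
      have := mul_le_mul_of_nonneg_left hV (norm_nonneg S)
      have h2 : ‖S‖ * (2 * N / q) = 2 * (‖S‖ * (N / q)) := by ring
      linarith
    calc q * T ^ k ≤ q * (‖S‖ * (2 * N / q)) ^ k := by gcongr
      _ = q * (‖S‖ ^ k * ((2 * N) ^ k / q ^ k)) := by rw [mul_pow, div_pow]
      _ ≤ q * (C * (q : ℝ) ^ (k - 1) * ((2 * N) ^ k / q ^ k)) := by gcongr
      _ = C * (2 * N) ^ k * ((q * q ^ (k - 1)) / q ^ k) := by ring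
      _ = C * (2 * N) ^ k := by rw [hqk, div_self (by positivity), mul_one]
  · obtain rfl | hβ1 := eq_or_ne β 0
    · have hC0 : 0 ≤ C := by
        have : 0 ≤ C * (q : ℝ) ^ (k - 1) := le_trans (by positivity) hC
        exact nonneg_of_mul_nonneg_left this (by positivity)
      simp only [abs_zero, mul_zero, zero_mul]
      positivity
    have hβpos : 0 < |β| := abs_pos.2 hβ1
    set X : ℝ := (|β| * q ^ k) ^ (-(1 / k : ℝ)) with hX
    have hX0 : 0 < X := by positivity
    have hXk : |β| * q ^ k * X ^ k = 1 := by
      rw [hX, ← Real.rpow_mul_natCast (by positivity),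
        neg_mul, one_div_mul_cancel (by positivity), Real.rpow_neg_one,
        mul_inv_cancel₀ (by positivity)]
    have habs : |β * (q : ℝ) ^ k| = |β| * q ^ k := by
      rw [abs_mul, abs_of_nonneg (pow_nonneg hq0.le k)]
    have hV := norm_sum_eF_pow_le hk hX0 (by rw [habs]; exact hXk) (N / q)
    rw [habs] at hV
    have h1 : |β| * q ^ k * ((N / q : ℕ) : ℝ) ^ k ≤ |β| * N ^ k := by
      rw [mul_assoc, ← mul_pow]
      gcongr
      rw [mul_comm]
      exact_mod_cast Nat.div_mul_le_self N q
    have hV2 : ‖V‖ ≤ 1 + 2 * X + 4 * Real.pi * (|β| * N ^ k) := by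
      have : 4 * Real.pi * (|β| * q ^ k) * ((N / q : ℕ) : ℝ) ^ k =
        4 * Real.pi * (|β| * q ^ k * ((N / q : ℕ) : ℝ) ^ k) := by ring
      nlinarith
    have hS : ‖S‖ ≤ q := norm_powSum_le k q a
    have h2 : ‖S‖ * ‖V‖ ≤ 14 * D + 2 * X * ‖S‖ := by
      calc ‖S‖ * ‖V‖ ≤ ‖S‖ * (1 + 2 * X + 4 * Real.pi * (|β| * N ^ k)) := by gcongr
        _ = ‖S‖ * (1 + 4 * Real.pi * (|β| * N ^ k)) + 2 * X * ‖S‖ := by ring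
        _ ≤ q * (1 + 4 * Real.pi * (|β| * N ^ k)) + 2 * X * ‖S‖ := by gcongr
        _ = q + 4 * Real.pi * (q * |β| * N ^ k) + 2 * X * ‖S‖ := by ring
        _ ≤ 14 * D + 2 * X * ‖S‖ := by nlinarith
    have h3 : T ≤ 4 * X * ‖S‖ := by linarith
    calc q * |β| * T ^ k ≤ q * |β| * (4 * X * ‖S‖) ^ k := by gcongr
      _ = q * |β| * 4 ^ k * X ^ k * ‖S‖ ^ k := by ring
      _ ≤ q * |β| * 4 ^ k * X ^ k * (C * (q : ℝ) ^ (k - 1)) := by gcongr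
      _ = C * 4 ^ k * (|β| * (q * q ^ (k - 1)) * X ^ k) := by ring
      _ = C * 4 ^ k := by rw [hqk, hXk, mul_one]

lemma norm_sum_eF_neg_pow (k n : ℕ) (θ : ℝ) :
    ‖∑ x ∈ Finset.range n, eF (θ * (-(x : ℝ)) ^ k)‖ =
      ‖∑ x ∈ Finset.range n, eF (θ * (x : ℝ) ^ k)‖ := by
  obtain hk | hk := k.even_or_odd
  · simp only [hk.neg_pow]
  · simp only [hk.neg_pow, mul_neg, eF_neg]
    rw [← map_sum, Complex.norm_conj]

lemma sum_Icc_neg_eq {M : Type*} [AddCommGroup M] (g : ℤ → M) (n : ℕ) :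
    ∑ x ∈ Finset.Icc (-(n : ℤ)) n, g x =
      ∑ x ∈ Finset.range (n + 1), g x + ∑ x ∈ Finset.range (n + 1), g (-x) - g 0 := by
  induction n with
  | zero => simp
  | succ n ih =>
    rw [Nat.cast_add, Nat.cast_one, Finset.Icc_succ_succ, Finset.sum_union (by simp),
      Finset.sum_pair (by lia), ih, Finset.sum_range_succ _ (n + 1),
      Finset.sum_range_succ _ (n + 1)]
    push_cast
    abel

lemma norm_fW_le (k : ℕ) {P : ℝ} (hP : 0 ≤ P) (θ : ℝ) :
    ‖fW k P θ‖ ≤ 1 + 2 * ‖∑ x ∈ Finset.range (⌊P⌋₊ + 1), eF (θ * (x : ℝ) ^ k)‖ := by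
  rw [fW, ← Int.natCast_floor_eq_floor hP, sum_Icc_neg_eq fun x : ℤ => eF (θ * (x : ℝ) ^ k)]
  have h := norm_sum_eF_neg_pow k (⌊P⌋₊ + 1) θ
  push_cast
  refine (norm_sub_le _ _).trans ?_
  have h2 := norm_add_le (∑ x ∈ Finset.range (⌊P⌋₊ + 1), eF (θ * (x : ℝ) ^ k))
    (∑ x ∈ Finset.range (⌊P⌋₊ + 1), eF (θ * (-(x : ℝ)) ^ k))
  rw [norm_eF]
  linarith

lemma exists_reduced_approx {θ : ℝ} {q : ℕ} (hq : 1 ≤ q) (a : ℤ) :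
    ∃ (q' : ℕ) (a' : ℤ), 1 ≤ q' ∧ q' ≤ q ∧ IsCoprime a' q' ∧ |q' * θ - a'| ≤ |q * θ - a| := by
  obtain ⟨g, a', q', hg, hcop, ha, hq'⟩ := Int.exists_gcd_one' (m := a) (n := q)
    (Int.gcd_pos_of_ne_zero_right _ (by exact_mod_cast (by omega : q ≠ 0)))
  have hq'pos : 0 < q' := by
    have : (0 : ℤ) < q' * g := by rw [← hq']; exact_mod_cast hq
    exact pos_of_mul_pos_left this (by positivity)
  lift q' to ℕ using hq'pos.le
  have hqg : q = q' * g := by exact_mod_cast hq'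
  refine ⟨q', a', by exact_mod_cast hq'pos, hqg ▸ Nat.le_mul_of_pos_right _ hg,
    Int.isCoprime_iff_gcd_eq_one.2 hcop, ?_⟩
  have hg1 : (1 : ℝ) ≤ g := by exact_mod_cast hg
  rw [hqg, ha]
  push_cast
  rw [show (q' * g * θ - a' * g : ℝ) = g * (q' * θ - a') by ring, abs_mul, Nat.abs_cast]
  exact le_mul_of_one_le_left (abs_nonneg _) hg1

/-- For k ≥ 2 and δ = 8^{−2k} there is K ≥ 1, depending only on k, such
that for all sufficiently large P: if λ ≠ 0 and |f(λα)| ≥ P^{1−11δ}, then there are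
integers a, q with 1 ≤ q ≤ K P^{11kδ} and |λα − a/q| ≤ q^{−1} K P^{11kδ−k}. -/
theorem stmt13 (k : ℕ) (hk : 2 ≤ k) :
    ∃ K : ℝ, 1 ≤ K ∧ ∃ P₁ : ℝ, ∀ P : ℝ, P₁ ≤ P → ∀ lam α : ℝ, lam ≠ 0 →
      P ^ (1 - 11 * dlt k) ≤ ‖fW k P (lam * α)‖ →
      ∃ a : ℤ, ∃ q : ℕ, 1 ≤ q ∧ (q : ℝ) ≤ K * P ^ (11 * (k : ℝ) * dlt k) ∧
        |lam * α - (a : ℝ) / q| ≤ (q : ℝ)⁻¹ * K * P ^ (11 * (k : ℝ) * dlt k - k) := by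
  have hk1 : 1 ≤ k := by omega
  obtain ⟨C₀, hC₀, hweyl⟩ := exists_rat_approx_of_large_weyl_sum hk1
  obtain ⟨C, hC, hlocal⟩ := exists_norm_powSum_pow_le hk
  set A : ℝ := 176 * (C₀ * 8 ^ 16 ^ k) with hA
  have hA1 : 1 ≤ A := by
    have : (1 : ℝ) ≤ 8 ^ 16 ^ k := one_le_pow₀ (by norm_num)
    nlinarith
  refine ⟨C * 16 ^ k, one_le_mul_of_one_le_of_one_le hC (one_le_pow₀ (by norm_num)), A ^ 4,
    fun P hP lam α _ hF => ?_⟩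
  set θ := lam * α
  set η : ℝ := 11 * dlt k with hη
  have hη0 : 0 ≤ η := by unfold η dlt; positivity
  have hη64 : η = 11 * (64 ^ k)⁻¹ := by
    rw [hη, dlt, pow_mul]
    norm_num
  have hη1 : η ≤ 1 / 16 := by
    have : (64 : ℝ) ^ 2 ≤ 64 ^ k := pow_le_pow_right₀ (by norm_num) hk
    rw [hη64, ← div_eq_mul_inv, div_le_iff₀ (by positivity)]
    linarith
  have hη16 : η * (16 : ℝ) ^ k ≤ 11 / 16 := by
    have h4 : (4 : ℝ) ^ 2 ≤ 4 ^ k := pow_le_pow_right₀ (by norm_num) hk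
    have : (64 : ℝ) ^ k = 4 ^ k * 16 ^ k := by rw [← mul_pow]; norm_num
    rw [hη64, this, mul_inv, mul_assoc, inv_mul_cancel_right₀ (by positivity),
      ← div_eq_mul_inv, div_le_div_iff₀ (by positivity) (by norm_num)]
    linarith
  have hP1 : 1 ≤ P := (one_le_pow₀ hA1).trans hP
  have hP0 : 0 < P := by linarith
  set N := ⌊P⌋₊ + 1
  have hPN : P ≤ N := by
    have := (Nat.lt_floor_add_one P).le
    push_cast [N]
    exact this
  have hNP : (N : ℝ) ≤ 2 * P := by
    have := Nat.floor_le hP0.le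
    push_cast [N]
    linarith
  have hN0 : (0 : ℝ) < N := by linarith
  set R : ℝ := 8 * P ^ η with hR
  have hPη : 1 ≤ P ^ η := Real.one_le_rpow hP1 hη0
  have hR1 : 1 ≤ R := by linarith
  set D : ℝ := C₀ * R ^ 16 ^ k with hD
  set T : ℝ := P ^ (1 - η) / 4 with hT
  have hD1 : 1 ≤ D := one_le_mul_of_one_le_of_one_le hC₀ (one_le_pow₀ hR1)
  have hDT : 44 * D ≤ T := by
    have h1 : A ≤ P ^ (1 / 4 : ℝ) := by
      calc A = (A ^ 4) ^ (1 / 4 : ℝ) := by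
            rw [← Real.rpow_natCast_mul (by linarith)]
            norm_num
        _ ≤ P ^ (1 / 4 : ℝ) := by gcongr
    have h2 : (P ^ η) ^ 16 ^ k ≤ P ^ (11 / 16 : ℝ) := by
      rw [← Real.rpow_mul_natCast hP0.le]
      push_cast
      exact Real.rpow_le_rpow_of_exponent_le hP1 hη16
    calc 44 * D = A / 4 * (P ^ η) ^ 16 ^ k := by rw [hD, hR, hA, mul_pow]; ring
      _ ≤ P ^ (1 / 4 : ℝ) / 4 * P ^ (11 / 16 : ℝ) := by gcongr
      _ = P ^ (15 / 16 : ℝ) / 4 := by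
        rw [div_mul_eq_mul_div, ← Real.rpow_add hP0]
        norm_num
      _ ≤ T := by
        rw [hT]
        gcongr
        linarith
  have hTP : T ≤ P := by
    have : P ^ (1 - η) ≤ P ^ (1 : ℝ) := Real.rpow_le_rpow_of_exponent_le hP1 (by linarith)
    rw [Real.rpow_one] at this
    linarith
  have hPsub : P ^ (1 - η) * P ^ η = P := by
    rw [← Real.rpow_add hP0, sub_add_cancel, Real.rpow_one]
  have hTS : T ≤ ‖∑ x ∈ Finset.range N, eF (θ * (x : ℝ) ^ k)‖ := by
    have := norm_fW_le k hP0.le θ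
    linarith
  have hNR : N / R ≤ T := by
    rw [div_le_iff₀ (by linarith), hT, hR]
    linarith
  obtain ⟨q₀, hq₀, hq₀D, a₀, ha₀⟩ := hweyl R θ N hR1 (by linarith) (hNR.trans hTS)
  obtain ⟨q, a, hq, hqq₀, hcop, hqa⟩ := exists_reduced_approx (θ := θ) hq₀ a₀
  have hq0 : (0 : ℝ) < q := by exact_mod_cast hq
  have hqβ : q * |θ - a / q| = |q * θ - a| := by
    rw [← Nat.abs_cast q, ← abs_mul, Nat.abs_cast, mul_sub, mul_div_cancel₀ _ hq0.ne']
  obtain ⟨h1, h2⟩ := mul_pow_le_of_major_arc (N := N) (β := θ - a / q) (T := T) (D := D) hk1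
    (hlocal q a hq hcop) hq ((Nat.cast_le.2 hqq₀).trans hq₀D)
    (by rw [hqβ]; exact le_trans (by gcongr) ha₀) hDT (by simpa using hTS)
  have hPT : P ^ k = 4 ^ k * T ^ k * P ^ (11 * (k : ℝ) * dlt k) := by
    calc P ^ k = (P ^ (1 - η) * P ^ η) ^ k := by rw [hPsub]
      _ = (4 * T * P ^ η) ^ k := by rw [hT, mul_div_cancel₀ _ four_ne_zero]
      _ = 4 ^ k * T ^ k * (P ^ η) ^ k := by rw [mul_pow, mul_pow]
      _ = _ := by
        rw [← Real.rpow_mul_natCast hP0.le η k, hη]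
        congr 2
        ring
  have hT0 : 0 < T := by linarith
  have hE0 : 0 < P ^ (11 * (k : ℝ) * dlt k) := by positivity
  refine ⟨a, q, hq, ?_, ?_⟩
  · refine le_of_mul_le_mul_right ?_ (pow_pos hT0 k)
    calc q * T ^ k ≤ C * (2 * N) ^ k := h1
      _ ≤ C * (4 * P) ^ k := mul_le_mul_of_nonneg_left
        (pow_le_pow_left₀ (by positivity) (by linarith) k) (by linarith)
      _ = C * 4 ^ k * P ^ k := by rw [mul_pow, mul_assoc]
      _ = C * (4 ^ k * 4 ^ k) * P ^ (11 * (k : ℝ) * dlt k) * T ^ k := by rw [hPT]; ring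
      _ = _ := by rw [← mul_pow]; norm_num
  · rw [mul_assoc, ← div_eq_inv_mul, le_div_iff₀' hq0, Real.rpow_sub hP0, Real.rpow_natCast]
    refine le_of_mul_le_mul_right ?_ (pow_pos hT0 k)
    refine h2.trans_eq ?_
    have h16 : (16 : ℝ) ^ k = 4 ^ k * 4 ^ k := by rw [← mul_pow]; norm_num
    rw [hPT, h16]
    field_simp
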